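/- There exist universal constants c, C > 0 such that for every finite poset P and every x ∈ P: c · (1/q(x) − 1) ≤ σ(x) ≤ C / q(x). (In particular σ(x) = Θ(1/q(x)).) -/

import Mathlib

open Finset

section Defs
variable (α : Type*) [Fintype α] [PartialOrder α]

/-- Linear extensions of a finite poset `α` with `n` elements: order-preserving
bijections to `Fin n` (representing the target `{1,…,n}`). -/
def LinExt : Type _ :=
  {f : α ≃ Fin (Fintype.card α) // ∀ x y : α, x < y → f x < f y}

instance : Finite (LinExt α) := by unfold LinExt; infer_instance

noncomputable instance : Fintype (LinExt α) := Fintype.ofFinite _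

end Defs

section Defs2
variable {α : Type*} [Fintype α] [PartialOrder α]

/-- the uniform probability `ℙ(E)` of an event `E` on linear extensions -/
noncomputable def Pr (E : LinExt α → Prop) : ℝ :=
  (Nat.card {f : LinExt α // E f} : ℝ) / (Nat.card (LinExt α) : ℝ)

/-- the value `f(x) ∈ {1,…,n}` of a linear extension at `x` -/
def val (f : LinExt α) (x : α) : ℕ := (f.1 x : ℕ) + 1

/-- `ℙ(x ≺ y)`, the probability that `x` precedes `y` in a uniform linear extension -/
noncomputable def prLT (x y : α) : ℝ := Pr (fun f => val f x < val f y)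

/-- the expectation `𝔼 f(x)` for `f` uniform on `E(P)` -/
noncomputable def expec (x : α) : ℝ :=
  (∑ f : LinExt α, (val f x : ℝ)) / (Nat.card (LinExt α) : ℝ)

/-- the variance `Var(f(x))` for `f` uniform on `E(P)` -/
noncomputable def variance (x : α) : ℝ :=
  (∑ f : LinExt α, ((val f x : ℝ) - expec x) ^ 2) / (Nat.card (LinExt α) : ℝ)

/-- the standard deviation `σ(x)` of `f(x)` -/
noncomputable def sigma (x : α) : ℝ := Real.sqrt (variance x)

/-- `π(x)`: the number of elements of the poset incomparable to `x` -/
noncomputable def piVal (x : α) : ℕ := Nat.card {y : α // ¬ x ≤ y ∧ ¬ y ≤ x}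

/-- `q(x) = max_{k ∈ {1,…,n}} ℙ(f(x) = k)` -/
noncomputable def qVal (x : α) : ℝ :=
  ⨆ k : Fin (Fintype.card α), Pr (fun f => val f x = (k : ℕ) + 1)

end Defs2

section Hyperbolic
variable {ι : Type*} [Fintype ι]

/-- If `S` is symmetric and `z` is orthogonal to every eigenvector of `S` with a positive
eigenvalue, then `⟨z, S z⟩ ≤ 0`. -/
theorem dotProduct_mulVec_nonpos_of_eigenvectors [DecidableEq ι] {S : Matrix ι ι ℝ}
    (hS : S.IsHermitian) (z : ι → ℝ)
    (h : ∀ (t : ℝ) (b : ι → ℝ), 0 < t → b ≠ 0 → S.mulVec b = t • b → ∑ i, b i * z i = 0) :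
    ∑ i, z i * (S.mulVec z) i ≤ 0 := by
  set B := hS.eigenvectorBasis with hB
  set c : ι → ℝ := fun k => ∑ i, (B k) i * z i with hc
  have hz : z = ∑ k, c k • (B k : ι → ℝ) := by
    have := B.sum_repr' (WithLp.toLp 2 z)
    have h2 := congrArg (fun v : EuclideanSpace ℝ ι => (v : ι → ℝ)) this
    simp only [WithLp.ofLp_sum, WithLp.ofLp_smul] at h2
    rw [← h2]
    refine Finset.sum_congr rfl fun k _ => ?_
    congr 1
    simp [hc, PiLp.inner_apply, mul_comm]
  have hSz : S.mulVec z = ∑ k, (c k * hS.eigenvalues k) • (B k : ι → ℝ) := by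
    conv_lhs => rw [hz]
    rw [Matrix.mulVec_sum]
    refine Finset.sum_congr rfl fun k _ => ?_
    rw [Matrix.mulVec_smul, hS.mulVec_eigenvectorBasis, smul_smul]
  have : ∑ i, z i * (S.mulVec z) i = ∑ k, hS.eigenvalues k * c k ^ 2 := by
    rw [hSz]
    simp only [Finset.sum_apply, Pi.smul_apply, smul_eq_mul, Finset.mul_sum]
    rw [Finset.sum_comm]
    refine Finset.sum_congr rfl fun k _ => ?_
    have hck : ∑ i, (B k) i * z i = c k := rfl
    calc ∑ i, z i * (c k * hS.eigenvalues k * (B k) i)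
        = hS.eigenvalues k * c k * ∑ i, (B k) i * z i := by
          rw [Finset.mul_sum]
          exact Finset.sum_congr rfl fun i _ => by ring
      _ = hS.eigenvalues k * c k ^ 2 := by rw [hck]; ring
  rw [this]
  refine Finset.sum_nonpos fun k _ => ?_
  by_cases hk : 0 < hS.eigenvalues k
  · have hne : (B k : ι → ℝ) ≠ 0 := by
      intro h0
      have := B.orthonormal.ne_zero k
      exact this (by ext i; simpa using congrFun h0 i)
    have := h _ _ hk hne (hS.mulVec_eigenvectorBasis k)
    have hck : c k = 0 := this
    simp [hck]
  · exact mul_nonpos_of_nonpos_of_nonneg (not_lt.mp hk) (sq_nonneg _)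

theorem sum_weighted_sq_sub (M : Matrix ι ι ℝ) (hM : ∀ i j, M i j = M j i) {h : ι → ℝ}
    (hh : ∀ i, 0 < h i) (x : ι → ℝ) :
    ∑ i, ∑ j, M i j * h i * h j * (x i / h i - x j / h j) ^ 2
      = 2 * (∑ i, x i ^ 2 * (M.mulVec h i / h i) - ∑ i, x i * M.mulVec x i) := by
  have e : ∀ i j, M i j * h i * h j * (x i / h i - x j / h j) ^ 2
      = x i ^ 2 * (M i j * h j / h i) + x j ^ 2 * (M j i * h i / h j)
          - 2 * (x i * (M i j * x j)) := by
    intro i j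
    have := (hh i).ne'
    have := (hh j).ne'
    rw [hM j i]
    field_simp
    ring
  simp only [e, Finset.sum_sub_distrib, Finset.sum_add_distrib]
  rw [Finset.sum_comm (f := fun i j => x j ^ 2 * (M j i * h i / h j))]
  simp only [← Finset.mul_sum, ← Finset.sum_div, Matrix.mulVec, dotProduct]
  ring

/-- A Bochner-type criterion: a connected nonnegative symmetric matrix `M` with a positive vector
`h` satisfying `⟨x, M x⟩ ≤ ∑ hᵢ (M x)ᵢ² / (M h)ᵢ` is negative semidefinite on the orthogonal
complement of `M h`. -/
theorem form_nonpos_of_orthogonal (M : Matrix ι ι ℝ) (h : ι → ℝ)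
    (hM : ∀ i j, M i j = M j i) (hM0 : ∀ i j, 0 ≤ M i j) (hh : ∀ i, 0 < h i)
    (hconn : ∀ g : ι → ℝ, (∀ i j, 0 < M i j → g i = g j) →
      ∀ i j, 0 < M.mulVec h i → 0 < M.mulVec h j → g i = g j)
    (key : ∀ x : ι → ℝ, ∑ i, x i * M.mulVec x i ≤ ∑ i, h i * (M.mulVec x i ^ 2 / M.mulVec h i))
    (u : ι → ℝ) (hu : ∑ i, u i * M.mulVec h i = 0) :
    ∑ i, u i * M.mulVec u i ≤ 0 := by
  classical
  set m := M.mulVec h with hm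
  have hm0 : ∀ i, 0 ≤ m i := fun i =>
    Finset.sum_nonneg fun j _ => mul_nonneg (hM0 i j) (hh j).le
  have hrow : ∀ i, m i = 0 → ∀ v : ι → ℝ, M.mulVec v i = 0 := by
    intro i hi v
    have h1 := (Finset.sum_eq_zero_iff_of_nonneg
      (fun j _ => mul_nonneg (hM0 i j) (hh j).le)).1 hi
    refine Finset.sum_eq_zero fun j hj => ?_
    have := h1 j hj
    rcases mul_eq_zero.1 this with h2 | h2
    · change M i j * v j = 0
      rw [h2, zero_mul]
    · exact absurd h2 (hh j).ne'
  set d : ι → ℝ := fun i => if m i = 0 then 1 else m i / h i with hd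
  have hdpos : ∀ i, 0 < d i := by
    intro i
    simp only [hd]
    split_ifs with hi
    · exact one_pos
    · exact div_pos (lt_of_le_of_ne (hm0 i) (Ne.symm hi)) (hh i)
  set s : ι → ℝ := fun i => Real.sqrt (d i) with hs
  have hspos : ∀ i, 0 < s i := fun i => Real.sqrt_pos.2 (hdpos i)
  have hss : ∀ i, s i * s i = d i := fun i => Real.mul_self_sqrt (hdpos i).le
  set S : Matrix ι ι ℝ := fun i j => M i j / (s i * s j) with hSdef
  have hSH : S.IsHermitian := by
    ext i j
    change M j i / (s j * s i) = M i j / (s i * s j)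
    rw [hM, mul_comm (s j)]
  have hSv : ∀ (v : ι → ℝ) i, S.mulVec v i = M.mulVec (fun j => v j / s j) i / s i := by
    intro v i
    simp only [Matrix.mulVec, dotProduct, hSdef, Finset.sum_div]
    refine Finset.sum_congr rfl fun j _ => ?_
    have := (hspos i).ne'
    have := (hspos j).ne'
    field_simp
  have main := dotProduct_mulVec_nonpos_of_eigenvectors hSH (fun i => s i * u i) ?_
  · convert main using 2 with i
    rw [hSv]
    have : (fun j => s j * u j / s j) = u := by
      funext j
      have := (hspos j).ne'
      field_simp
    rw [this]
    have := (hspos i).ne'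
    field_simp
  intro t b ht hb hev
  set x : ι → ℝ := fun i => b i / s i with hx
  have hbx : ∀ i, b i = s i * x i := by
    intro i
    have := (hspos i).ne'
    simp only [hx]; field_simp
  have hMx : ∀ i, M.mulVec x i = t * (d i * x i) := by
    intro i
    have h1 := congrFun hev i
    rw [hSv, Pi.smul_apply, smul_eq_mul, div_eq_iff (hspos i).ne', hbx i] at h1
    rw [← hss i]
    change M.mulVec x i = _ at h1
    rw [h1]; ring
  have hx0 : ∀ i, m i = 0 → x i = 0 := by
    intro i hi
    have h1 := hMx i
    rw [hrow i hi] at h1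
    have := (hdpos i).ne'
    simpa [ht.ne', this] using h1.symm
  set N : ℝ := ∑ i, d i * x i ^ 2 with hN
  have hNpos : 0 < N := by
    obtain ⟨i, hi⟩ : ∃ i, x i ≠ 0 := by
      by_contra hcon
      push Not at hcon
      exact hb (by funext i; rw [hbx, hcon]; simp)
    exact Finset.sum_pos' (fun i _ => mul_nonneg (hdpos i).le (sq_nonneg _))
      ⟨i, Finset.mem_univ _, mul_pos (hdpos i) (by positivity)⟩
  have hxMx : ∑ i, x i * M.mulVec x i = t * N := by
    rw [hN, Finset.mul_sum]
    refine Finset.sum_congr rfl fun i _ => ?_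
    rw [hMx]; ring
  have hkey : t * N ≤ t ^ 2 * N := by
    rw [← hxMx]
    refine (key x).trans (le_of_eq ?_)
    rw [hN, Finset.mul_sum]
    refine Finset.sum_congr rfl fun i _ => ?_
    rw [hMx]
    by_cases hi : m i = 0
    · rw [hx0 i hi]; simp
    · have := (hh i).ne'
      simp only [hd, if_neg hi]
      field_simp
  have hDx : ∑ i, x i ^ 2 * (m i / h i) = N := by
    refine Finset.sum_congr rfl fun i _ => ?_
    by_cases hi : m i = 0
    · rw [hx0 i hi]; simp
    · simp only [hd, if_neg hi]; ring
  have hsq := sum_weighted_sq_sub M hM hh x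
  rw [← hm, hDx, hxMx] at hsq
  have hterm : ∀ i j, 0 ≤ M i j * h i * h j * (x i / h i - x j / h j) ^ 2 := fun i j =>
    mul_nonneg (mul_nonneg (mul_nonneg (hM0 i j) (hh i).le) (hh j).le) (sq_nonneg _)
  have hnn : 0 ≤ ∑ i, ∑ j, M i j * h i * h j * (x i / h i - x j / h j) ^ 2 :=
    Finset.sum_nonneg fun i _ => Finset.sum_nonneg fun j _ => hterm i j
  have ht1 : t = 1 := by
    apply le_antisymm
    · by_contra hcon
      push Not at hcon
      nlinarith
    · by_contra hcon
      push Not at hcon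
      nlinarith [mul_pos ht hNpos]
  have hz : ∑ i, ∑ j, M i j * h i * h j * (x i / h i - x j / h j) ^ 2 = 0 := by
    rw [hsq, ht1]; ring
  have hedge : ∀ i j, 0 < M i j → x i / h i = x j / h j := by
    intro i j hij
    have h1 := (Finset.sum_eq_zero_iff_of_nonneg
      (fun i _ => Finset.sum_nonneg fun j _ => hterm i j)).1 hz i (Finset.mem_univ _)
    have h2 := (Finset.sum_eq_zero_iff_of_nonneg (fun j _ => hterm i j)).1 h1 j (Finset.mem_univ _)
    have h3 : (x i / h i - x j / h j) ^ 2 = 0 := by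
      rcases mul_eq_zero.1 h2 with h4 | h4
      · exact absurd h4 (mul_pos (mul_pos hij (hh i)) (hh j)).ne'
      · exact h4
    exact sub_eq_zero.1 (pow_eq_zero_iff two_ne_zero |>.1 h3)
  have hconst := hconn _ hedge
  have hprod : ∀ i, b i * (s i * u i) = x i / h i * (u i * m i) := by
    intro i
    by_cases hi : m i = 0
    · rw [hbx, hx0 i hi]; simp
    · have : b i * (s i * u i) = s i * s i * x i * u i := by rw [hbx]; ring
      rw [this, hss]
      simp only [hd, if_neg hi]; ring
  simp only [hprod]
  by_cases hex : ∃ i, 0 < m i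
  · obtain ⟨i₀, hi₀⟩ := hex
    have : ∀ i, x i / h i * (u i * m i) = x i₀ / h i₀ * (u i * m i) := by
      intro i
      rcases (hm0 i).eq_or_lt with hi | hi
      · rw [← hi]; simp
      · rw [hconst i i₀ hi hi₀]
    simp only [this, ← Finset.mul_sum, hu, mul_zero]
  · push Not at hex
    refine Finset.sum_eq_zero fun i _ => ?_
    rw [le_antisymm (hex i) (hm0 i)]; simp

/-- Under the assumptions of `form_nonpos_of_orthogonal`, the form of `M` satisfies the reverse
Cauchy–Schwarz inequality. -/
theorem form_reverse_cauchy_schwarz (M : Matrix ι ι ℝ) (h : ι → ℝ)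
    (hM : ∀ i j, M i j = M j i)
    (hneg : ∀ u : ι → ℝ, ∑ i, u i * M.mulVec h i = 0 → ∑ i, u i * M.mulVec u i ≤ 0)
    (u v : ι → ℝ) (hv : 0 < ∑ i, v i * M.mulVec v i) :
    (∑ i, u i * M.mulVec u i) * (∑ i, v i * M.mulVec v i) ≤ (∑ i, u i * M.mulVec v i) ^ 2 := by
  have hb : ∑ i, v i * M.mulVec h i ≠ 0 := fun h0 => (hneg v h0).not_gt hv
  set c := (∑ i, u i * M.mulVec h i) / ∑ i, v i * M.mulVec h i with hc
  have hsym : ∑ i, v i * M.mulVec u i = ∑ i, u i * M.mulVec v i := by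
    simp only [Matrix.mulVec, dotProduct, Finset.mul_sum]
    rw [Finset.sum_comm]
    refine Finset.sum_congr rfl fun i _ => Finset.sum_congr rfl fun j _ => ?_
    rw [hM j i]; ring
  have h1 := hneg (u - c • v) (by
    simp only [Pi.sub_apply, Pi.smul_apply, smul_eq_mul, sub_mul, mul_assoc,
      Finset.sum_sub_distrib, ← Finset.mul_sum]
    rw [hc, div_mul_cancel₀ _ hb, sub_self])
  have h2 : ∑ i, (u - c • v) i * M.mulVec (u - c • v) i
      = ∑ i, u i * M.mulVec u i - 2 * c * ∑ i, u i * M.mulVec v i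
        + c ^ 2 * ∑ i, v i * M.mulVec v i := by
    have : ∀ i, (u - c • v) i * M.mulVec (u - c • v) i = u i * M.mulVec u i
        - c * (u i * M.mulVec v i) - c * (v i * M.mulVec u i) + c ^ 2 * (v i * M.mulVec v i) := by
      intro i
      rw [Matrix.mulVec_sub, Matrix.mulVec_smul]
      simp only [Pi.sub_apply, Pi.smul_apply, smul_eq_mul]
      ring
    simp only [this, Finset.sum_add_distrib, Finset.sum_sub_distrib, ← Finset.mul_sum, hsym]
    ring
  rw [h2] at h1
  nlinarith [sq_nonneg (c * (∑ i, v i * M.mulVec v i) - ∑ i, u i * M.mulVec v i),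
    mul_le_mul_of_nonneg_left h1 hv.le]

end Hyperbolic

theorem sum_moves_eq {α : Type*} [Fintype α] {y z : α} (hyz : y ≠ z) (F : Bool × α → ℝ)
    (hF : ∀ i, i.2 ≠ y → i.2 ≠ z → F i = 0) :
    ∑ i, F i = (F (true, y) + F (false, y)) + (F (true, z) + F (false, z)) := by
  classical
  have : ∑ i, F i
      = ∑ i ∈ ({(true, y), (false, y), (true, z), (false, z)} : Finset (Bool × α)), F i := by
    refine (Finset.sum_subset (Finset.subset_univ _) fun i _ hi => hF i ?_ ?_).symm
    · rintro rfl
      exact hi (by rcases i with ⟨b, a⟩; cases b <;> simp)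
    · rintro rfl
      exact hi (by rcases i with ⟨b, a⟩; cases b <;> simp)
  rw [this, Finset.sum_insert (by simp [hyz]), Finset.sum_insert (by simp [hyz]),
    Finset.sum_insert (by simp), Finset.sum_singleton]
  ring

section Removal
open Classical

variable {α : Type*} [PartialOrder α] {x : α} {S : Finset α}

/-- `z` precedes `y` when read from the bottom (`b = true`) or from the top (`b = false`). -/
def Precedes (b : Bool) (z y : α) : Prop := if b then z < y else y < z

/-- The move `(b, y)` is available in `S` if `y ≠ x` is a minimal (`b = true`) or maximal
(`b = false`) element of `S`. -/
def Removable (x : α) (S : Finset α) (i : Bool × α) : Prop :=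
  i.2 ∈ S ∧ i.2 ≠ x ∧ ∀ z ∈ S, ¬ Precedes i.1 z i.2

theorem Removable.erase {i j : Bool × α} (hj : Removable x S j) (h : i.2 ≠ j.2) :
    Removable x (S.erase i.2) j :=
  ⟨Finset.mem_erase.2 ⟨h.symm, hj.1⟩, hj.2.1, fun z hz => hj.2.2 z (Finset.mem_of_mem_erase hz)⟩

theorem Removable.ne_of_erase {i j : Bool × α} (hj : Removable x (S.erase i.2) j) : i.2 ≠ j.2 :=
  (Finset.ne_of_mem_erase hj.1).symm

/-- A move unlocked by `i` was blocked by `i.2` only. -/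
theorem Removable.precedes_of_new {i k : Bool × α} (hk : Removable x (S.erase i.2) k)
    (hk' : ¬ Removable x S k) : Precedes k.1 i.2 k.2 := by
  by_contra h
  refine hk' ⟨Finset.mem_of_mem_erase hk.1, hk.2.1, fun z hz => ?_⟩
  by_cases hzi : z = i.2
  · rwa [hzi]
  · exact hk.2.2 z (Finset.mem_erase.2 ⟨hzi, hz⟩)

/-- A move unlocked by `i` has the same direction as `i`. -/
theorem Removable.fst_eq_of_new {i k : Bool × α} (hi : Removable x S i)
    (hk : Removable x (S.erase i.2) k) (hk' : ¬ Removable x S k) : k.1 = i.1 := by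
  have h := hk.precedes_of_new hk'
  have h2 := hi.2.2 k.2 (Finset.mem_of_mem_erase hk.1)
  rcases hb : k.1 <;> rcases hc : i.1 <;> simp_all [Precedes]

theorem Removable.mem_erase {i : Bool × α} (hi : Removable x S i) (hx : x ∈ S) :
    x ∈ S.erase i.2 := Finset.mem_erase.2 ⟨hi.2.1.symm, hx⟩

theorem Removable.card_erase {i : Bool × α} (hi : Removable x S i) : #(S.erase i.2) + 1 = #S :=
  Finset.card_erase_add_one hi.1

theorem exists_removable (hx : x ∈ S) (hS : 2 ≤ #S) : ∃ i, Removable x S i := by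
  by_cases h : ∃ z ∈ S, ¬ x ≤ z
  · obtain ⟨z, hz, hxz⟩ := h
    obtain ⟨m, hm⟩ := (S.filter fun w => ¬ x ≤ w).exists_minimal ⟨z, by simp [hz, hxz]⟩
    have hm1 := Finset.mem_filter.1 hm.1
    refine ⟨(true, m), hm1.1, fun h => hm1.2 (le_of_eq h.symm), fun w hw hlt => ?_⟩
    simp only [Precedes, if_true] at hlt
    have := hm.2 (y := w) (by simp [hw]; exact fun h => hm1.2 (h.trans hlt.le)) hlt.le
    exact (lt_irrefl _ (hlt.trans_le this))
  · push Not at h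
    have hne : (S.erase x).Nonempty := by
      rw [← Finset.card_pos, Finset.card_erase_of_mem hx]; omega
    obtain ⟨m, hm⟩ := (S.erase x).exists_maximal hne
    have hm1 := Finset.mem_erase.1 hm.1
    refine ⟨(false, m), hm1.2, hm1.1, fun w hw hlt => ?_⟩
    simp only [Precedes, Bool.false_eq_true, if_false] at hlt
    by_cases hwx : w = x
    · subst hwx
      exact lt_irrefl _ (hlt.trans_le (h m hm1.2))
    · exact lt_irrefl _ (hlt.trans_le (hm.2 (y := w) (by simp [hw, hwx]) hlt.le))

/-- Transport of weights along the move `i`: the moves that `i` unlocks inherit its weight. -/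
noncomputable def transport (x : α) (S : Finset α) (i : Bool × α) (v : Bool × α → ℝ) :
    Bool × α → ℝ :=
  fun j => if Removable x S j then v j else v i

/-- The weight vector on moves given by a weight on directions. -/
def dirWeight (w : Bool → ℝ) : Bool × α → ℝ := fun i => w i.1

theorem transport_dirWeight {i k : Bool × α} (w : Bool → ℝ) (hi : Removable x S i)
    (hk : Removable x (S.erase i.2) k) : transport x S i (dirWeight w) k = w k.1 := by
  unfold transport dirWeight
  split_ifs with h
  · rfl
  · rw [hi.fst_eq_of_new hk h]

/-- Transporting along two commuting moves in either order gives weights whose difference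
has the right sign. -/
theorem transport_transport_sub_nonneg {i j k : Bool × α} (w : Bool → ℝ) (hw : ∀ b, 0 ≤ w b)
    (v : Bool × α → ℝ) (hi : Removable x S i) (hj : Removable x S j) (hij : i.2 ≠ j.2)
    (hk : Removable x ((S.erase i.2).erase j.2) k) :
    0 ≤ (w i.1 * v j - v i * w j.1) *
      (transport x (S.erase i.2) j (transport x S i v) k
        - transport x (S.erase j.2) i (transport x S j v) k) := by
  have hji : Removable x (S.erase i.2) j := hj.erase hij
  have hij' : Removable x (S.erase j.2) i := hi.erase hij.symm
  have hk' : Removable x ((S.erase j.2).erase i.2) k := by rwa [Finset.erase_right_comm]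
  have hki : k.2 ≠ i.2 := (hk'.ne_of_erase).symm
  have hkj : k.2 ≠ j.2 := (hk.ne_of_erase).symm
  by_cases hk0 : Removable x S k
  · have h1 := hk0.erase hki.symm
    have h2 := hk0.erase hkj.symm
    simp [transport, hk0, h1, h2]
  by_cases h1 : Removable x (S.erase i.2) k
  · have h2 : ¬ Removable x (S.erase j.2) k := fun h2 =>
      h1.precedes_of_new hk0 |> h2.2.2 i.2 (Finset.mem_erase.2 ⟨hij, hi.1⟩)
    simp [transport, hk0, h1, h2, hi]
  by_cases h2 : Removable x (S.erase j.2) k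
  · simp [transport, hk0, h1, h2, hj]
  have e1 : k.1 = j.1 := hji.fst_eq_of_new hk h1
  have e2 : k.1 = i.1 := hij'.fst_eq_of_new hk' h2
  have : transport x (S.erase i.2) j (transport x S i v) k
        - transport x (S.erase j.2) i (transport x S j v) k = v j - v i := by
    simp [transport, h1, h2, hi, hj]
  rw [this, ← e1, ← e2]
  nlinarith [mul_nonneg (hw k.1) (sq_nonneg (v j - v i))]

variable [Fintype α]

/-- The weighted count of the ways to remove elements other than `x` from `S` one after the
other, each from the bottom or from the top, with weights given by the list. -/
noncomputable def removalSum (x : α) : Finset α → List (Bool → ℝ) → ℝ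
  | _, [] => 1
  | S, w :: L => ∑ i : Bool × α, if Removable x S i then w i.1 * removalSum x (S.erase i.2) L else 0

/-- The matrix of second derivatives of the weighted removal count. -/
noncomputable def removalMatrix (x : α) (S : Finset α) (L : List (Bool → ℝ)) :
    Matrix (Bool × α) (Bool × α) ℝ := fun i j =>
  (if Removable x S i ∧ Removable x S j ∧ i.2 ≠ j.2
    then removalSum x ((S.erase i.2).erase j.2) L else 0)
  + if i = j ∧ Removable x S i then
      ∑ k, if Removable x (S.erase i.2) k ∧ ¬ Removable x S k
        then removalSum x ((S.erase i.2).erase k.2) L else 0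
    else 0

theorem removalMatrix_symm (L : List (Bool → ℝ)) (i j : Bool × α) :
    removalMatrix x S L i j = removalMatrix x S L j i := by
  unfold removalMatrix
  congr 1
  · rw [Finset.erase_right_comm]
    congr 1
    simp only [eq_iff_iff, ne_eq, eq_comm (a := i.2)]
    tauto
  · by_cases h : i = j
    · rw [h]
    · rw [if_neg (fun h' => h h'.1), if_neg (fun h' => h h'.1.symm)]

theorem removalSum_nonneg {L : List (Bool → ℝ)} (hL : ∀ w ∈ L, ∀ b, 0 ≤ w b) :
    0 ≤ removalSum x S L := by
  induction L generalizing S with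
  | nil => simp [removalSum]
  | cons w L ih =>
    refine Finset.sum_nonneg fun i _ => ?_
    split_ifs
    · exact mul_nonneg (hL w (by simp) _) (ih fun w hw => hL w (by simp [hw]))
    · exact le_rfl

theorem removalMatrix_nonneg {L : List (Bool → ℝ)} (hL : ∀ w ∈ L, ∀ b, 0 ≤ w b) (i j : Bool × α) :
    0 ≤ removalMatrix x S L i j := by
  refine add_nonneg ?_ ?_
  · split_ifs
    · exact removalSum_nonneg hL
    · exact le_rfl
  · split_ifs
    · refine Finset.sum_nonneg fun k _ => ?_
      split_ifs
      · exact removalSum_nonneg hL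
      · exact le_rfl
    · exact le_rfl

theorem removalMatrix_mulVec (L : List (Bool → ℝ)) (v : Bool × α → ℝ) (i : Bool × α) :
    (removalMatrix x S L).mulVec v i = if Removable x S i then
      ∑ j, if Removable x (S.erase i.2) j
        then transport x S i v j * removalSum x ((S.erase i.2).erase j.2) L else 0 else 0 := by
  unfold Matrix.mulVec dotProduct removalMatrix
  split_ifs with hi
  · simp only [add_mul, Finset.sum_add_distrib, hi, true_and, and_true, ite_mul, zero_mul,
      Finset.sum_ite_eq, Finset.mem_univ, if_true, Finset.sum_mul]
    rw [← Finset.sum_add_distrib]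
    refine Finset.sum_congr rfl fun j _ => ?_
    unfold transport
    by_cases hj : Removable x S j
    · by_cases hij : i.2 = j.2
      · have : ¬ Removable x (S.erase i.2) j := fun h => h.ne_of_erase hij
        simp [hij]
        rw [hij] at this
        simp [this]
      · simp [hj, hij, hj.erase hij, mul_comm]
    · simp [hj, mul_comm]
  · simp [hi]

theorem removalMatrix_mulVec_dirWeight (L : List (Bool → ℝ)) (w : Bool → ℝ) (i : Bool × α) :
    (removalMatrix x S L).mulVec (dirWeight w) i
      = if Removable x S i then removalSum x (S.erase i.2) (w :: L) else 0 := by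
  rw [removalMatrix_mulVec]
  split_ifs with hi
  · refine Finset.sum_congr rfl fun j _ => ?_
    split_ifs with hj
    · rw [transport_dirWeight w hi hj]
    · rfl
  · rfl

/-- The quadratic form of the removal matrix. -/
noncomputable def removalForm (x : α) (S : Finset α) (L : List (Bool → ℝ))
    (u v : Bool × α → ℝ) : ℝ := ∑ i, u i * (removalMatrix x S L).mulVec v i

theorem removalForm_comm (L : List (Bool → ℝ)) (u v : Bool × α → ℝ) :
    removalForm x S L u v = removalForm x S L v u := by
  unfold removalForm
  simp only [Matrix.mulVec, dotProduct, Finset.mul_sum]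
  rw [Finset.sum_comm]
  refine Finset.sum_congr rfl fun i _ => Finset.sum_congr rfl fun j _ => ?_
  rw [removalMatrix_symm]; ring

theorem removalForm_dirWeight (L : List (Bool → ℝ)) (w w' : Bool → ℝ) :
    removalForm x S L (dirWeight w) (dirWeight w') = removalSum x S (w :: w' :: L) := by
  unfold removalForm
  rw [removalSum]
  refine Finset.sum_congr rfl fun i _ => ?_
  rw [removalMatrix_mulVec_dirWeight]
  split_ifs <;> simp [dirWeight]

/-- The rows of the removal matrix are pairings in the smaller sets. -/
theorem removalMatrix_mulVec_cons (L : List (Bool → ℝ)) (w : Bool → ℝ) (v : Bool × α → ℝ)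
    {i : Bool × α} (hi : Removable x S i) :
    (removalMatrix x S (w :: L)).mulVec v i
      = removalForm x (S.erase i.2) L (transport x S i v) (dirWeight w) := by
  rw [removalMatrix_mulVec, if_pos hi]
  unfold removalForm
  refine Finset.sum_congr rfl fun j _ => ?_
  rw [removalMatrix_mulVec_dirWeight]
  split_ifs <;> simp

theorem removalForm_transport_dirWeight (L : List (Bool → ℝ)) (w : Bool → ℝ)
    {i : Bool × α} (hi : Removable x S i) (u : Bool × α → ℝ) :
    removalForm x (S.erase i.2) L (transport x S i (dirWeight w)) u
      = removalForm x (S.erase i.2) L (dirWeight w) u := by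
  refine Finset.sum_congr rfl fun j _ => ?_
  rw [removalMatrix_mulVec]
  split_ifs with hj
  · rw [transport_dirWeight w hi hj]; rfl
  · simp

theorem removalSum_swap (L : List (Bool → ℝ)) (w w' : Bool → ℝ) :
    removalSum x S (w :: w' :: L) = removalSum x S (w' :: w :: L) := by
  rw [← removalForm_dirWeight, removalForm_comm, removalForm_dirWeight]

theorem removalSum_perm {L L' : List (Bool → ℝ)} (h : L.Perm L') :
    removalSum x S L = removalSum x S L' := by
  induction h generalizing S with
  | nil => rfl
  | cons w _ ih =>
    simp only [removalSum]
    refine Finset.sum_congr rfl fun i _ => ?_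
    rw [ih]
  | swap w w' L => exact removalSum_swap L w' w
  | trans _ _ h1 h2 => rw [h1, h2]

theorem removalSum_pos {L : List (Bool → ℝ)} (hL : ∀ w ∈ L, ∀ b, 0 < w b) (hx : x ∈ S)
    (hS : #S = L.length + 1) : 0 < removalSum x S L := by
  induction L generalizing S with
  | nil => simp [removalSum]
  | cons w L ih =>
    have hL' : ∀ w ∈ L, ∀ b, 0 < w b := fun w hw => hL w (by simp [hw])
    obtain ⟨i, hi⟩ := exists_removable hx (by rw [hS]; simp)
    refine Finset.sum_pos' (fun j _ => ?_) ⟨i, Finset.mem_univ _, ?_⟩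
    · split_ifs
      · exact mul_nonneg (hL w (by simp) _).le (removalSum_nonneg fun w hw b => (hL' w hw b).le)
      · exact le_rfl
    · rw [if_pos hi]
      have := hi.card_erase
      exact mul_pos (hL w (by simp) _) (ih hL' (hi.mem_erase hx) (by simp at hS; omega))

theorem removalMatrix_connected {L : List (Bool → ℝ)} (hL : ∀ w ∈ L, ∀ b, 0 < w b) (hx : x ∈ S)
    (hS : #S = L.length + 3) (g : Bool × α → ℝ)
    (hg : ∀ i j, 0 < removalMatrix x S L i j → g i = g j) {i j : Bool × α}
    (hi : Removable x S i) (hj : Removable x S j) : g i = g j := by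
  have hne : ∀ i j, Removable x S i → Removable x S j → i.2 ≠ j.2 → g i = g j := by
    intro i j hi hj hij
    refine hg i j ?_
    unfold removalMatrix
    rw [if_pos ⟨hi, hj, hij⟩, if_neg (fun h => hij (by rw [h.1])), add_zero]
    have h1 := hi.card_erase
    have h2 := (hj.erase hij).card_erase
    exact removalSum_pos hL ((hj.erase hij).mem_erase (hi.mem_erase hx)) (by omega)
  by_cases h2 : i.2 = j.2
  · by_cases h1 : i.1 = j.1
    · rw [Prod.ext h1 h2]
    · have hc := hi.card_erase
      obtain ⟨k, hk⟩ := exists_removable (hi.mem_erase hx) (by omega)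
      have hk' : Removable x S k := by
        by_contra hk'
        exact h1 ((hi.fst_eq_of_new hk hk').symm.trans
          (hj.fst_eq_of_new (by rwa [← h2]) hk'))
      rw [hne i k hi hk' hk.ne_of_erase, hne k j hk' hj (by rw [← h2]; exact hk.ne_of_erase.symm)]
  · exact hne i j hi hj h2

theorem removalForm_eq_sum (L : List (Bool → ℝ)) (u v : Bool × α → ℝ) :
    removalForm x S L u v = ∑ i, ∑ j, if Removable x S i ∧ Removable x (S.erase i.2) j
      then u i * transport x S i v j * removalSum x ((S.erase i.2).erase j.2) L else 0 := by
  unfold removalForm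
  refine Finset.sum_congr rfl fun i _ => ?_
  rw [removalMatrix_mulVec]
  by_cases hi : Removable x S i
  · simp only [hi, if_true, true_and, Finset.mul_sum, mul_ite, mul_zero, mul_assoc]
  · simp [hi]

theorem removalForm_cons_eq_sum (L : List (Bool → ℝ)) (w : Bool → ℝ) (v : Bool × α → ℝ) :
    removalForm x S (w :: L) v v = ∑ i, ∑ j, ∑ k,
      if Removable x S i ∧ Removable x (S.erase i.2) j ∧ Removable x ((S.erase i.2).erase j.2) k
      then v i * w j.1 * transport x (S.erase i.2) j (transport x S i v) k
        * removalSum x (((S.erase i.2).erase j.2).erase k.2) L else 0 := by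
  unfold removalForm
  refine Finset.sum_congr rfl fun i _ => ?_
  by_cases hi : Removable x S i
  · rw [removalMatrix_mulVec_cons L w v hi, removalForm_comm, removalForm_eq_sum, Finset.mul_sum]
    refine Finset.sum_congr rfl fun j _ => ?_
    rw [Finset.mul_sum]
    refine Finset.sum_congr rfl fun k _ => ?_
    simp only [hi, true_and, mul_ite, mul_zero, dirWeight, mul_assoc]
  · rw [removalMatrix_mulVec]
    simp [hi]

theorem sum_removalForm_eq_sum (L : List (Bool → ℝ)) (w : Bool → ℝ) (v : Bool × α → ℝ) :
    (∑ i, if Removable x S i then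
      w i.1 * removalForm x (S.erase i.2) L (transport x S i v) (transport x S i v) else 0)
    = ∑ i, ∑ j, ∑ k,
      if Removable x S i ∧ Removable x (S.erase i.2) j ∧ Removable x ((S.erase i.2).erase j.2) k
      then w i.1 * transport x S i v j * transport x (S.erase i.2) j (transport x S i v) k
        * removalSum x (((S.erase i.2).erase j.2).erase k.2) L else 0 := by
  refine Finset.sum_congr rfl fun i _ => ?_
  by_cases hi : Removable x S i
  · rw [if_pos hi, removalForm_eq_sum, Finset.mul_sum]
    refine Finset.sum_congr rfl fun j _ => ?_
    rw [Finset.mul_sum]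
    refine Finset.sum_congr rfl fun k _ => ?_
    simp only [hi, true_and, mul_ite, mul_zero, mul_assoc]
  · simp [hi]

theorem removalForm_cons_le (L : List (Bool → ℝ)) (hL : ∀ w ∈ L, ∀ b, 0 ≤ w b)
    (w : Bool → ℝ) (hw : ∀ b, 0 ≤ w b) (v : Bool × α → ℝ) :
    removalForm x S (w :: L) v v ≤ ∑ i, if Removable x S i then
      w i.1 * removalForm x (S.erase i.2) L (transport x S i v) (transport x S i v) else 0 := by
  rw [removalForm_cons_eq_sum, sum_removalForm_eq_sum, ← sub_nonneg]
  simp only [← Finset.sum_sub_distrib]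
  set F : Bool × α → Bool × α → Bool × α → ℝ := fun i j k =>
    if Removable x S i ∧ Removable x S j ∧ i.2 ≠ j.2 ∧ Removable x ((S.erase i.2).erase j.2) k
    then (w i.1 * v j - v i * w j.1) * transport x (S.erase i.2) j (transport x S i v) k
      * removalSum x (((S.erase i.2).erase j.2).erase k.2) L else 0 with hF
  have hdiff : ∀ i j k,
      (if Removable x S i ∧ Removable x (S.erase i.2) j ∧ Removable x ((S.erase i.2).erase j.2) k
      then w i.1 * transport x S i v j * transport x (S.erase i.2) j (transport x S i v) k
        * removalSum x (((S.erase i.2).erase j.2).erase k.2) L else 0)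
      - (if Removable x S i ∧ Removable x (S.erase i.2) j ∧
          Removable x ((S.erase i.2).erase j.2) k
      then v i * w j.1 * transport x (S.erase i.2) j (transport x S i v) k
        * removalSum x (((S.erase i.2).erase j.2).erase k.2) L else 0) = F i j k := by
    intro i j k
    simp only [hF]
    by_cases h : Removable x S i ∧ Removable x (S.erase i.2) j ∧
      Removable x ((S.erase i.2).erase j.2) k
    · rw [if_pos h, if_pos h]
      by_cases hj : Removable x S j
      · rw [if_pos ⟨h.1, hj, h.2.1.ne_of_erase, h.2.2⟩]
        have : transport x S i v j = v j := by simp [transport, hj]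
        rw [this]; ring
      · rw [if_neg (fun h' => hj h'.2.1)]
        have : transport x S i v j = v i := by simp [transport, hj]
        rw [this, h.1.fst_eq_of_new h.2.1 hj]; ring
    · rw [if_neg h, if_neg h, if_neg (fun h' => h ⟨h'.1, h'.2.1.erase h'.2.2.1, h'.2.2.2⟩), sub_zero]
  simp only [hdiff]
  have hsym : ∑ i, ∑ j, ∑ k, F i j k = ∑ i, ∑ j, ∑ k, F j i k := Finset.sum_comm
  have hpos : 0 ≤ ∑ i, ∑ j, ∑ k, (F i j k + F j i k) := by
    refine Finset.sum_nonneg fun i _ => Finset.sum_nonneg fun j _ => Finset.sum_nonneg fun k _ => ?_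
    simp only [hF]
    by_cases h : Removable x S i ∧ Removable x S j ∧ i.2 ≠ j.2 ∧
      Removable x ((S.erase i.2).erase j.2) k
    · rw [if_pos h, if_pos ⟨h.2.1, h.1, h.2.2.1.symm, by
        rw [Finset.erase_right_comm]; exact h.2.2.2⟩, Finset.erase_right_comm (a := j.2) (b := i.2)]
      have h1 := transport_transport_sub_nonneg w hw v h.1 h.2.1 h.2.2.1 h.2.2.2
      have h2 := mul_nonneg h1
        (removalSum_nonneg (x := x) (S := ((S.erase i.2).erase j.2).erase k.2) hL)
      linarith
    · rw [if_neg h, if_neg (fun h' => h ⟨h'.2.1, h'.1, h'.2.2.1.symm, by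
        rw [Finset.erase_right_comm]; exact h'.2.2.2⟩), add_zero]
  simp only [Finset.sum_add_distrib] at hpos
  linarith

/-- The inductive step: the reverse Cauchy–Schwarz inequality passes from the smaller sets. -/
theorem removalForm_reverse_cauchy_schwarz_step {L : List (Bool → ℝ)} {w : Bool → ℝ}
    (hL : ∀ w ∈ L, ∀ b, 0 < w b) (hw : ∀ b, 0 < w b) (hx : x ∈ S) (hS : #S = L.length + 4)
    (ih : ∀ i, Removable x S i → ∀ u v, 0 < removalForm x (S.erase i.2) L v v →
      removalForm x (S.erase i.2) L u u * removalForm x (S.erase i.2) L v v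
        ≤ removalForm x (S.erase i.2) L u v ^ 2)
    (u v : Bool × α → ℝ) (hv : 0 < removalForm x S (w :: L) v v) :
    removalForm x S (w :: L) u u * removalForm x S (w :: L) v v
        ≤ removalForm x S (w :: L) u v ^ 2 := by
  have hwL : ∀ w' ∈ w :: L, ∀ b, 0 < w' b := by
    intro w' hw'
    rcases List.mem_cons.1 hw' with rfl | h
    · exact hw
    · exact hL _ h
  have hact : ∀ i, 0 < (removalMatrix x S (w :: L)).mulVec (dirWeight w) i → Removable x S i := by
    intro i h
    by_contra hi
    rw [removalMatrix_mulVec_dirWeight, if_neg hi] at h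
    exact lt_irrefl _ h
  refine form_reverse_cauchy_schwarz _ (dirWeight w) (removalMatrix_symm _)
    (form_nonpos_of_orthogonal _ (dirWeight w) (removalMatrix_symm _)
      (removalMatrix_nonneg fun w' hw' b => (hwL w' hw' b).le) (fun i => hw i.1) ?_ ?_) u v hv
  · intro g hg i j hi hj
    exact removalMatrix_connected hwL hx (by simpa using hS) g hg (hact i hi) (hact j hj)
  · intro y
    refine (removalForm_cons_le L (fun w hw b => (hL w hw b).le) w (fun b => (hw b).le) y).trans ?_
    refine Finset.sum_le_sum fun i _ => ?_
    by_cases hi : Removable x S i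
    · rw [if_pos hi]
      have hc := hi.card_erase
      have hform : (removalMatrix x S (w :: L)).mulVec (dirWeight w) i
          = removalForm x (S.erase i.2) L (dirWeight w) (dirWeight w) := by
        rw [removalMatrix_mulVec_cons L w _ hi, removalForm_transport_dirWeight L w hi]
      have hpos : 0 < removalForm x (S.erase i.2) L (dirWeight w) (dirWeight w) := by
        rw [removalForm_dirWeight]
        refine removalSum_pos ?_ (hi.mem_erase hx) (by simp; omega)
        simp only [List.mem_cons]
        rintro w' (rfl | rfl | h)
        exacts [hw, hw, hL _ h]
      rw [hform, removalMatrix_mulVec_cons L w _ hi]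
      refine mul_le_mul_of_nonneg_left ?_ (hw i.1).le
      rw [le_div_iff₀ hpos]
      exact ih i hi _ _ hpos
    · rw [if_neg hi, removalMatrix_mulVec_dirWeight, if_neg hi, div_zero, mul_zero]

theorem removalForm_nil {y z : α} (hyz : y ≠ z) (hy : y ≠ x) (hz : z ≠ x)
    (u v : Bool × α → ℝ) :
    removalForm x {x, y, z} [] u v =
      ∑ b, ((if ¬ Precedes b x y ∧ ¬ Precedes b z y then u (b, y) * ∑ c,
        (if ¬ Precedes c x z then
          (if ¬ Precedes c x z ∧ ¬ Precedes c y z then v (c, z) else v (b, y)) else 0) else 0)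
      + (if ¬ Precedes b x z ∧ ¬ Precedes b y z then u (b, z) * ∑ c,
        (if ¬ Precedes c x y then
          (if ¬ Precedes c x y ∧ ¬ Precedes c z y then v (c, y) else v (b, z)) else 0) else 0)) := by
  have hirr : ∀ b (a : α), ¬ Precedes b a a := by
    intro b a; cases b <;> simp [Precedes]
  have rem2 : ∀ b (a : α), a ≠ x → (Removable x {x, a} (b, a) ↔ ¬ Precedes b x a) := by
    intro b a ha
    simp [Removable, ha, hirr]
  have sum2 : ∀ (a : α), a ≠ x → ∀ t : Bool × α → ℝ,
      ∑ j, (if Removable x {x, a} j then t j else 0)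
        = ∑ c, if ¬ Precedes c x a then t (c, a) else 0 := by
    intro a ha t
    rw [sum_moves_eq ha]
    · have : ∀ b, ¬ Removable x {x, a} (b, x) := fun b h => h.2.1 rfl
      simp only [rem2 _ a ha, this, if_false, add_zero, Fintype.sum_bool]
    · intro i h1 h2
      rw [if_neg]
      intro h
      have := h.1
      simp [h1, h2] at this
  have remy : ∀ b, Removable x {x, y, z} (b, y) ↔ ¬ Precedes b x y ∧ ¬ Precedes b z y := by
    intro b; simp [Removable, hy, hirr]
  have remz : ∀ b, Removable x {x, y, z} (b, z) ↔ ¬ Precedes b x z ∧ ¬ Precedes b y z := by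
    intro b; simp [Removable, hz, hirr]
  have ery : ({x, y, z} : Finset α).erase y = {x, z} := by
    ext a; simp only [Finset.mem_erase, Finset.mem_insert, Finset.mem_singleton]
    constructor
    · tauto
    · rintro (rfl | rfl)
      · exact ⟨hy.symm, by simp⟩
      · exact ⟨hyz.symm, by simp⟩
  have erz : ({x, y, z} : Finset α).erase z = {x, y} := by
    ext a; simp only [Finset.mem_erase, Finset.mem_insert, Finset.mem_singleton]
    constructor
    · tauto
    · rintro (rfl | rfl)
      · exact ⟨hz.symm, by simp⟩
      · exact ⟨hyz, by simp⟩
  unfold removalForm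
  simp only [removalMatrix_mulVec, removalSum, mul_one]
  rw [sum_moves_eq hyz]
  · simp only [ery, erz, sum2 z hz, sum2 y hy, transport, remy, remz, mul_ite, mul_zero,
      Fintype.sum_bool]
    ring
  · intro i h1 h2
    rw [if_neg, mul_zero]
    intro h
    have h3 := h.1
    have h4 := h.2.1
    simp [h1, h2, h4] at h3

theorem removalForm_nil_of_lt {y z : α} (hlt : y < z) (hy : y ≠ x) (hz : z ≠ x)
    (u v : Bool × α → ℝ) :
    removalForm x {x, y, z} [] u u * removalForm x {x, y, z} [] v v
      ≤ removalForm x {x, y, z} [] u v ^ 2 := by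
  have h1 : ¬ z < y := hlt.asymm
  have h2 : x < y → x < z := fun h => h.trans hlt
  have h3 : z < x → y < x := fun h => hlt.trans h
  simp only [removalForm_nil hlt.ne hy hz, Fintype.sum_bool, Precedes, if_true,
    Bool.false_eq_true, if_false, hlt, h1, not_true, not_false_iff, and_true, and_false]
  by_cases a1 : x < y <;> by_cases a2 : x < z <;> by_cases a3 : z < x <;> by_cases a4 : y < x <;>
    simp only [a1, a2, a3, a4, not_true, not_false_iff, if_true, if_false] <;>
    first
      | (exfalso; tauto)
      | nlinarith [sq_nonneg (u (true, y) * v (false, z) - v (true, y) * u (false, z))]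

theorem removalForm_nil_of_incomp {y z : α} (hyz : y ≠ z) (h1 : ¬ y < z) (h2 : ¬ z < y)
    (hy : y ≠ x) (hz : z ≠ x) (u v : Bool × α → ℝ) :
    removalForm x {x, y, z} [] u u * removalForm x {x, y, z} [] v v
      ≤ removalForm x {x, y, z} [] u v ^ 2 := by
  have hp : ∀ b, ¬ Precedes b z y := by intro b; cases b <;> simp [Precedes, h1, h2]
  have hp' : ∀ b, ¬ Precedes b y z := by intro b; cases b <;> simp [Precedes, h1, h2]
  set Y : (Bool × α → ℝ) → ℝ := fun u => ∑ b, if ¬ Precedes b x y then u (b, y) else 0 with hY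
  set Z : (Bool × α → ℝ) → ℝ := fun u => ∑ b, if ¬ Precedes b x z then u (b, z) else 0 with hZ
  have key : ∀ u v, removalForm x {x, y, z} [] u v = Y u * Z v + Z u * Y v := by
    intro u v
    have e1 : ∀ (b c : Bool), (if ¬ Precedes c x z then
        (if ¬ Precedes c x z then v (c, z) else v (b, y)) else 0)
        = if ¬ Precedes c x z then v (c, z) else 0 := by
      intro b c; split_ifs <;> rfl
    have e2 : ∀ (b c : Bool), (if ¬ Precedes c x y then
        (if ¬ Precedes c x y then v (c, y) else v (b, z)) else 0)
        = if ¬ Precedes c x y then v (c, y) else 0 := by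
      intro b c; split_ifs <;> rfl
    simp only [removalForm_nil hyz hy hz, hp, hp', not_false_iff, and_true, e1, e2, hY, hZ,
      Finset.sum_add_distrib, Finset.sum_mul, ite_mul, zero_mul]
  rw [key, key, key]
  nlinarith [sq_nonneg (Y u * Z v - Z u * Y v)]

theorem removalForm_nil_reverse_cauchy_schwarz (hx : x ∈ S) (hS : #S = 3)
    (u v : Bool × α → ℝ) :
    removalForm x S [] u u * removalForm x S [] v v ≤ removalForm x S [] u v ^ 2 := by
  obtain ⟨y, z, hyz, hSe⟩ := Finset.card_eq_two.1
    (show #(S.erase x) = 2 by rw [Finset.card_erase_of_mem hx, hS])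
  have hy : y ≠ x := Finset.ne_of_mem_erase (by rw [hSe]; simp)
  have hz : z ≠ x := Finset.ne_of_mem_erase (by rw [hSe]; simp : z ∈ S.erase x)
  have hS' : S = {x, y, z} := by rw [← Finset.insert_erase hx, hSe]
  rw [hS']
  by_cases h1 : y < z
  · exact removalForm_nil_of_lt h1 hy hz u v
  by_cases h2 : z < y
  · rw [Finset.pair_comm]
    exact removalForm_nil_of_lt h2 hz hy u v
  exact removalForm_nil_of_incomp hyz h1 h2 hy hz u v

theorem removalForm_reverse_cauchy_schwarz {L : List (Bool → ℝ)} (hL : ∀ w ∈ L, ∀ b, 0 < w b)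
    (hx : x ∈ S) (hS : #S = L.length + 3) (u v : Bool × α → ℝ)
    (hv : 0 < removalForm x S L v v) :
    removalForm x S L u u * removalForm x S L v v ≤ removalForm x S L u v ^ 2 := by
  induction L generalizing S u v with
  | nil => exact removalForm_nil_reverse_cauchy_schwarz hx hS u v
  | cons w L ih =>
    have hL' : ∀ w ∈ L, ∀ b, 0 < w b := fun w hw => hL w (by simp [hw])
    refine removalForm_reverse_cauchy_schwarz_step hL' (hL w (by simp)) hx (by simpa using hS)
      (fun i hi u v hv => ?_) u v hv
    have := hi.card_erase
    exact ih hL' (hi.mem_erase hx) (by simp at hS; omega) u v hv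

/-- The Alexandrov–Fenchel type inequality for weighted removal counts. -/
theorem removalSum_mul_le_sq {L : List (Bool → ℝ)} (hL : ∀ w ∈ L, ∀ b, 0 < w b)
    {a b : Bool → ℝ} (hb : ∀ c, 0 < b c) (hx : x ∈ S) (hS : #S = L.length + 3) :
    removalSum x S (a :: a :: L) * removalSum x S (b :: b :: L)
      ≤ removalSum x S (a :: b :: L) ^ 2 := by
  simp only [← removalForm_dirWeight]
  refine removalForm_reverse_cauchy_schwarz hL hx hS _ _ ?_
  rw [removalForm_dirWeight]
  refine removalSum_pos ?_ hx (by simpa using hS)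
  simp only [List.mem_cons]
  rintro w (rfl | rfl | h)
  exacts [hb, hb, hL _ h]

end Removal

section Counting
open Classical

variable {α : Type*} [PartialOrder α] {x : α} {S : Finset α}

/-- `f` restricts to a linear extension of `S` with values in `{0, …, #S - 1}` taking the value
`k` at `x`, and vanishes outside `S`. -/
structure IsExt (x : α) (S : Finset α) (k : ℕ) (f : α → ℕ) : Prop where
  eq_zero : ∀ z ∉ S, f z = 0
  inj : ∀ y ∈ S, ∀ z ∈ S, f y = f z → y = z
  lt_card : ∀ z ∈ S, f z < #S
  mono : ∀ y ∈ S, ∀ z ∈ S, y < z → f y < f z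
  apply_eq : f x = k

theorem IsExt.exists_eq {k : ℕ} {f : α → ℕ} (hf : IsExt x S k f) {m : ℕ} (hm : m < #S) :
    ∃ y ∈ S, f y = m := by
  have h1 : S.image f ⊆ Finset.range #S := by
    intro a ha
    obtain ⟨z, hz, rfl⟩ := Finset.mem_image.1 ha
    exact Finset.mem_range.2 (hf.lt_card z hz)
  have h2 : #(S.image f) = #S := Finset.card_image_of_injOn fun y hy z hz h => hf.inj y hy z hz h
  have h3 := Finset.eq_of_subset_of_card_le h1 (by rw [h2, Finset.card_range])
  have : m ∈ S.image f := by rw [h3]; exact Finset.mem_range.2 hm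
  exact Finset.mem_image.1 this

theorem IsExt.insert_bottom {k : ℕ} {y : α} {g : α → ℕ} (hx : x ∈ S)
    (hy : Removable x S (true, y)) (hg : IsExt x (S.erase y) k g) :
    IsExt x S (k + 1) (fun z => if z ∈ S.erase y then g z + 1 else 0) := by
  have hc : #(S.erase y) + 1 = #S := hy.card_erase
  have hmin : ∀ z ∈ S, ¬ z < y := fun z hz => by simpa [Precedes] using hy.2.2 z hz
  refine ⟨fun z hz => ?_, fun a ha b hb hab => ?_, fun z hz => ?_, fun a ha b hb hab => ?_, ?_⟩
  · rw [if_neg (fun h => hz (Finset.mem_of_mem_erase h))]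
  · by_cases h1 : a = y <;> by_cases h2 : b = y
    · rw [h1, h2]
    · simp [h1, h2, hb] at hab
    · simp [h1, h2, ha] at hab
    · have ha' := Finset.mem_erase.2 ⟨h1, ha⟩
      have hb' := Finset.mem_erase.2 ⟨h2, hb⟩
      simp only [ha', hb', if_true] at hab
      exact hg.inj a ha' b hb' (by omega)
  · split_ifs with h
    · have := hg.lt_card z h; omega
    · omega
  · have h2 : b ≠ y := fun h => hmin a ha (h ▸ hab)
    have hb' := Finset.mem_erase.2 ⟨h2, hb⟩
    by_cases h1 : a = y
    · simp [h1, h2, hb]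
    · have ha' := Finset.mem_erase.2 ⟨h1, ha⟩
      simp only [ha', hb', if_true]
      have := hg.mono a ha' b hb' hab
      omega
  · simp only [hy.mem_erase hx, if_true, hg.apply_eq]

theorem IsExt.erase_bottom {k : ℕ} {y : α} {f : α → ℕ} (hx : x ∈ S)
    (hf : IsExt x S (k + 1) f) (hy : y ∈ S) (hfy : f y = 0) :
    Removable x S (true, y) ∧ IsExt x (S.erase y) k (fun z => f z - 1) := by
  have hne : y ≠ x := by
    rintro rfl
    have := hf.apply_eq
    omega
  have hc := Finset.card_erase_add_one hy
  have hpos : ∀ z ∈ S.erase y, 0 < f z := by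
    intro z hz
    refine Nat.pos_of_ne_zero fun h => Finset.ne_of_mem_erase hz ?_
    exact hf.inj z (Finset.mem_of_mem_erase hz) y hy (by rw [h, hfy])
  refine ⟨⟨hy, hne, fun z hz h => ?_⟩, fun z hz => ?_, fun a ha b hb hab => ?_, fun z hz => ?_,
    fun a ha b hb hab => ?_, ?_⟩
  · have := hf.mono z hz y hy (by simpa [Precedes] using h)
    omega
  · by_cases h : z = y
    · simp [h, hfy]
    · simp [hf.eq_zero z (fun h' => hz (Finset.mem_erase.2 ⟨h, h'⟩))]
  · have := hpos a ha
    have := hpos b hb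
    exact hf.inj a (Finset.mem_of_mem_erase ha) b (Finset.mem_of_mem_erase hb) (by omega)
  · have := hf.lt_card z (Finset.mem_of_mem_erase hz)
    have := hpos z hz
    omega
  · have := hpos a ha
    have := hf.mono a (Finset.mem_of_mem_erase ha) b (Finset.mem_of_mem_erase hb) hab
    omega
  · simp [hf.apply_eq]

theorem IsExt.insert_top {k : ℕ} {y : α} {g : α → ℕ}
    (hy : Removable x S (false, y)) (hg : IsExt x (S.erase y) k g) :
    IsExt x S k (fun z => if z = y then #S - 1 else g z) := by
  have hc : #(S.erase y) + 1 = #S := hy.card_erase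
  have hmax : ∀ z ∈ S, ¬ y < z := fun z hz => by simpa [Precedes] using hy.2.2 z hz
  refine ⟨fun z hz => ?_, fun a ha b hb hab => ?_, fun z hz => ?_, fun a ha b hb hab => ?_, ?_⟩
  · rw [if_neg (fun h : z = y => hz (h ▸ hy.1))]
    exact hg.eq_zero z fun h => hz (Finset.mem_of_mem_erase h)
  · by_cases h1 : a = y <;> by_cases h2 : b = y
    · rw [h1, h2]
    · have := hg.lt_card b (Finset.mem_erase.2 ⟨h2, hb⟩)
      simp only [h1, h2, if_true, if_false] at hab
      omega
    · have := hg.lt_card a (Finset.mem_erase.2 ⟨h1, ha⟩)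
      simp only [h1, h2, if_true, if_false] at hab
      omega
    · simp only [h1, h2, if_false] at hab
      exact hg.inj a (Finset.mem_erase.2 ⟨h1, ha⟩) b (Finset.mem_erase.2 ⟨h2, hb⟩) hab
  · split_ifs with h
    · omega
    · have := hg.lt_card z (Finset.mem_erase.2 ⟨h, hz⟩); omega
  · have h1 : a ≠ y := fun h => hmax b hb (h ▸ hab)
    have ha' := Finset.mem_erase.2 ⟨h1, ha⟩
    by_cases h2 : b = y
    · have := hg.lt_card a ha'
      simp only [h1, h2, if_true, if_false]
      omega
    · simp only [h1, h2, if_false]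
      exact hg.mono a ha' b (Finset.mem_erase.2 ⟨h2, hb⟩) hab
  · rw [if_neg (fun h => hy.2.1 h.symm), hg.apply_eq]

theorem IsExt.erase_top {k : ℕ} {y : α} {f : α → ℕ} (hk : k + 1 < #S)
    (hf : IsExt x S k f) (hy : y ∈ S) (hfy : f y = #S - 1) :
    Removable x S (false, y) ∧ IsExt x (S.erase y) k (fun z => if z = y then 0 else f z) := by
  have hne : y ≠ x := by
    rintro rfl
    have := hf.apply_eq
    omega
  have hc := Finset.card_erase_add_one hy
  refine ⟨⟨hy, hne, fun z hz h => ?_⟩, fun z hz => ?_, fun a ha b hb hab => ?_, fun z hz => ?_,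
    fun a ha b hb hab => ?_, ?_⟩
  · have := hf.mono y hy z hz (by simpa [Precedes] using h)
    have := hf.lt_card z hz
    omega
  · split_ifs with h
    · rfl
    · exact hf.eq_zero z (fun h' => hz (Finset.mem_erase.2 ⟨h, h'⟩))
  · simp only [Finset.ne_of_mem_erase ha, Finset.ne_of_mem_erase hb, if_false] at hab
    exact hf.inj a (Finset.mem_of_mem_erase ha) b (Finset.mem_of_mem_erase hb) hab
  · have h1 := hf.lt_card z (Finset.mem_of_mem_erase hz)
    have h2 : f z ≠ f y := fun h => Finset.ne_of_mem_erase hz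
      (hf.inj z (Finset.mem_of_mem_erase hz) y hy h)
    simp only [Finset.ne_of_mem_erase hz, if_false]
    omega
  · simp only [Finset.ne_of_mem_erase ha, Finset.ne_of_mem_erase hb, if_false]
    exact hf.mono a (Finset.mem_of_mem_erase ha) b (Finset.mem_of_mem_erase hb) hab
  · rw [if_neg hne.symm, hf.apply_eq]

/-- The number of linear extensions of `S` with value `k` (counted from `0`) at `x`. -/
noncomputable def extCount (x : α) (S : Finset α) (k : ℕ) : ℕ :=
  Nat.card {f : α → ℕ // IsExt x S k f}

theorem extCount_singleton : extCount x {x} 0 = 1 := by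
  unfold extCount
  rw [Nat.card_eq_one_iff_unique]
  refine ⟨⟨fun f g => Subtype.ext (funext fun z => ?_)⟩, ⟨⟨fun _ => 0, ?_⟩⟩⟩
  · have h : ∀ f : {f : α → ℕ // IsExt x {x} 0 f}, f.1 z = 0 := by
      intro f
      by_cases hz : z = x
      · rw [hz]; exact f.2.apply_eq
      · exact f.2.eq_zero z (by simpa using hz)
    rw [h, h]
  · constructor <;> simp

variable [Fintype α]

instance IsExt.finite (k : ℕ) : Finite {f : α → ℕ // IsExt x S k f} := by
  have : (Set.univ.pi fun _ : α => Set.Iic #S).Finite :=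
    Set.Finite.pi fun _ => Set.finite_Iic _
  refine (this.subset (t := {f | IsExt x S k f}) fun f hf z _ => ?_).to_subtype
  by_cases hz : z ∈ S
  · exact (hf.lt_card z hz).le
  · rw [hf.eq_zero z hz]; exact Nat.zero_le _

theorem extCount_succ (hx : x ∈ S) (k : ℕ) :
    extCount x S (k + 1)
      = ∑ y, if Removable x S (true, y) then extCount x (S.erase y) k else 0 := by
  rw [← Finset.sum_filter, ← Finset.sum_coe_sort]
  unfold extCount
  rw [← Nat.card_sigma]
  symm
  have hrem : ∀ y : {y // y ∈ univ.filter fun y => Removable x S (true, y)},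
      Removable x S (true, y.1) := fun y => (Finset.mem_filter.1 y.2).2
  refine Nat.card_eq_of_bijective
    (fun p => ⟨_, p.2.2.insert_bottom hx (hrem p.1)⟩) ⟨?_, ?_⟩
  · rintro ⟨⟨y, hy⟩, g, hg⟩ ⟨⟨y', hy'⟩, g', hg'⟩ h
    have h' := congrFun (Subtype.ext_iff.1 h)
    dsimp only at h'
    have hyy : y = y' := by
      by_contra hne
      have := h' y'
      simp [Ne.symm hne, (hrem ⟨y', hy'⟩).1] at this
    subst hyy
    have hgg : g = g' := by
      funext z
      by_cases hz : z ∈ S.erase y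
      · simpa [hz] using h' z
      · rw [hg.eq_zero z hz, hg'.eq_zero z hz]
    subst hgg
    rfl
  · rintro ⟨f, hf⟩
    obtain ⟨y, hy, hfy⟩ := hf.exists_eq (Finset.card_pos.2 ⟨x, hx⟩)
    obtain ⟨h1, h2⟩ := hf.erase_bottom hx hy hfy
    refine ⟨⟨⟨y, by simp [h1]⟩, _, h2⟩, Subtype.ext (funext fun z => ?_)⟩
    dsimp only
    by_cases hzy : z = y
    · simp [hzy, hfy]
    by_cases hz : z ∈ S
    · have : f z ≠ f y := fun h => hzy (hf.inj z hz y hy h)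
      rw [if_pos (Finset.mem_erase.2 ⟨hzy, hz⟩)]
      omega
    · rw [if_neg (fun h => hz (Finset.mem_of_mem_erase h)), hf.eq_zero z hz]

theorem extCount_of_lt (k : ℕ) (hk : k + 1 < #S) :
    extCount x S k
      = ∑ y, if Removable x S (false, y) then extCount x (S.erase y) k else 0 := by
  rw [← Finset.sum_filter, ← Finset.sum_coe_sort]
  unfold extCount
  rw [← Nat.card_sigma]
  symm
  have hrem : ∀ y : {y // y ∈ univ.filter fun y => Removable x S (false, y)},
      Removable x S (false, y.1) := fun y => (Finset.mem_filter.1 y.2).2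
  refine Nat.card_eq_of_bijective
    (fun p => ⟨_, p.2.2.insert_top (hrem p.1)⟩) ⟨?_, ?_⟩
  · rintro ⟨⟨y, hy⟩, g, hg⟩ ⟨⟨y', hy'⟩, g', hg'⟩ h
    have h' := congrFun (Subtype.ext_iff.1 h)
    dsimp only at h'
    have hyy : y = y' := by
      by_contra hne
      have h1 := h' y'
      have h2 := hg.lt_card y' (Finset.mem_erase.2 ⟨Ne.symm hne, (hrem ⟨y', hy'⟩).1⟩)
      have h3 : #(S.erase y) + 1 = #S := (hrem ⟨y, hy⟩).card_erase
      simp only [Ne.symm hne, if_true, if_false] at h1 h2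
      omega
    subst hyy
    have hgg : g = g' := by
      funext z
      by_cases hz : z = y
      · rw [hg.eq_zero z (by simp [hz]), hg'.eq_zero z (by simp [hz])]
      · simpa [hz] using h' z
    subst hgg
    rfl
  · rintro ⟨f, hf⟩
    obtain ⟨y, hy, hfy⟩ := hf.exists_eq (show #S - 1 < #S by omega)
    obtain ⟨h1, h2⟩ := hf.erase_top hk hy hfy
    refine ⟨⟨⟨y, by simp [h1]⟩, _, h2⟩, Subtype.ext (funext fun z => ?_)⟩
    dsimp only
    split_ifs with hzy
    · rw [hzy, hfy]
    · rfl

/-- The weight of direction `b` equal to `1` for `b = c` and to `ε` otherwise. -/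
def tiltWeight (ε : ℝ) (c : Bool) : Bool → ℝ := fun b => if b = c then 1 else ε

theorem removalSum_tiltWeight_zero (i j : ℕ) (hx : x ∈ S) (hS : #S = i + j + 1) :
    removalSum x S (List.replicate i (tiltWeight 0 true) ++ List.replicate j (tiltWeight 0 false))
      = extCount x S i := by
  have hsum : ∀ (T : Finset α) (c : Bool) (L : List (Bool → ℝ)),
      removalSum x T (tiltWeight 0 c :: L)
        = ∑ y, if Removable x T (c, y) then removalSum x (T.erase y) L else 0 := by
    intro T c L
    rw [removalSum, Fintype.sum_prod_type, Fintype.sum_bool]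
    cases c <;> simp [tiltWeight]
  induction i generalizing S with
  | zero =>
    induction j generalizing S with
    | zero =>
      obtain ⟨a, rfl⟩ := Finset.card_eq_one.1 (by simpa using hS)
      obtain rfl := Finset.mem_singleton.1 hx
      simp [removalSum, extCount_singleton]
    | succ j ih =>
      rw [List.replicate_zero, List.nil_append, List.replicate_succ, hsum,
        extCount_of_lt 0 (by omega)]
      push_cast
      refine Finset.sum_congr rfl fun y _ => ?_
      split_ifs with hy
      · have h : #(S.erase y) + 1 = #S := hy.card_erase
        simpa using ih (S := S.erase y) (hy.mem_erase hx) (by omega)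
      · rfl
  | succ i ih =>
    rw [List.replicate_succ, List.cons_append, hsum, extCount_succ hx]
    push_cast
    refine Finset.sum_congr rfl fun y _ => ?_
    split_ifs with hy
    · have h : #(S.erase y) + 1 = #S := hy.card_erase
      exact ih (S := S.erase y) (hy.mem_erase hx) (by omega)
    · rfl

theorem continuous_removalSum_tiltWeight (S : Finset α) (l : List Bool) :
    Continuous fun ε => removalSum x S (l.map (tiltWeight ε)) := by
  induction l generalizing S with
  | nil => simpa [removalSum] using continuous_const
  | cons c l ih =>
    simp only [List.map_cons, removalSum]
    refine continuous_finsetSum _ fun i _ => ?_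
    split_ifs
    · refine Continuous.mul ?_ (ih _)
      unfold tiltWeight
      split_ifs
      · exact continuous_const
      · exact continuous_id
    · exact continuous_const

/-- A positive sequence which is log-concave up to `m` satisfies the four-term inequality. -/
theorem mul_le_mul_of_log_concave {a : ℕ → ℝ} {m : ℕ} (hpos : ∀ k ≤ m, 0 < a k)
    (hlc : ∀ k, k + 2 ≤ m → a (k + 2) * a k ≤ a (k + 1) ^ 2) (i s t : ℕ) (h : i + s + t ≤ m) :
    a i * a (i + s + t) ≤ a (i + s) * a (i + t) := by
  have step : ∀ i t, i + t + 1 ≤ m → a i * a (i + t + 1) ≤ a (i + 1) * a (i + t) := by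
    intro i t
    induction t with
    | zero => intro _; rw [mul_comm, add_zero]
    | succ t ih =>
      intro h
      have h0 := hpos i (by omega)
      have h1 := hpos (i + t) (by omega)
      have h2 := hpos (i + t + 1) (by omega)
      have h3 := ih (by omega)
      have h4 := hlc (i + t) (by omega)
      have h5 := hpos (i + t + 2) (by omega)
      refine le_of_mul_le_mul_right ?_ (mul_pos h1 h2)
      calc a i * a (i + t + 2) * (a (i + t) * a (i + t + 1))
          = (a i * a (i + t + 1)) * (a (i + t + 2) * a (i + t)) := by ring
        _ ≤ (a (i + 1) * a (i + t)) * a (i + t + 1) ^ 2 :=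
            mul_le_mul h3 h4 (mul_pos h5 h1).le (mul_pos (hpos _ (by omega)) h1).le
        _ = a (i + 1) * a (i + t + 1) * (a (i + t) * a (i + t + 1)) := by ring
  induction s with
  | zero => simp
  | succ s ih =>
    have h0 := hpos (i + s) (by omega)
    have h1 := hpos (i + s + t) (by omega)
    have h2 := hpos (i + s + t + 1) (by omega)
    have h3 := ih (by omega)
    have h4 := step (i + s) t (by omega)
    have h5 := hpos (i + t) (by omega)
    refine le_of_mul_le_mul_right ?_ (mul_pos h0 h1)
    rw [show i + (s + 1) + t = i + s + t + 1 by omega, show i + (s + 1) = i + s + 1 by omega]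
    calc a i * a (i + s + t + 1) * (a (i + s) * a (i + s + t))
        = (a i * a (i + s + t)) * (a (i + s) * a (i + s + t + 1)) := by ring
      _ ≤ (a (i + s) * a (i + t)) * (a (i + s + 1) * a (i + s + t)) :=
          mul_le_mul h3 h4 (mul_pos h0 h2).le (mul_pos h0 h5).le
      _ = a (i + s + 1) * a (i + t) * (a (i + s) * a (i + s + t)) := by ring

/-- Log-concavity of the number of linear extensions with a given value at `x`, in a form that
also rules out internal zeros. -/
theorem extCount_mul_le_mul (hx : x ∈ S) (i s t : ℕ) (h : i + s + t < #S) :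
    (extCount x S i * extCount x S (i + s + t) : ℝ)
      ≤ extCount x S (i + s) * extCount x S (i + t) := by
  obtain ⟨m, hm⟩ : ∃ m, #S = m + 1 := ⟨#S - 1, by omega⟩
  set l : ℕ → List Bool := fun k => List.replicate k true ++ List.replicate (m - k) false with hl
  set a : ℝ → ℕ → ℝ := fun ε k => removalSum x S ((l k).map (tiltWeight ε)) with ha
  have hlen : ∀ k ≤ m, (l k).length = m := by
    intro k hk
    simp only [hl, List.length_append, List.length_replicate]
    omega
  have htilt : ∀ ε : ℝ, 0 < ε → ∀ c b, 0 < tiltWeight ε c b := by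
    intro ε hε c b
    unfold tiltWeight
    split_ifs
    exacts [one_pos, hε]
  have hmap : ∀ ε : ℝ, 0 < ε → ∀ l : List Bool, ∀ w ∈ l.map (tiltWeight ε), ∀ b, 0 < w b := by
    intro ε hε l w hw
    obtain ⟨c, _, rfl⟩ := List.mem_map.1 hw
    exact htilt ε hε c
  have hineq : ∀ ε : ℝ, 0 < ε → a ε i * a ε (i + s + t) ≤ a ε (i + s) * a ε (i + t) := by
    intro ε hε
    refine mul_le_mul_of_log_concave (m := m)
      (fun k hk => removalSum_pos (hmap ε hε _) hx (by simp [hlen k hk, hm]))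
      (fun k hk => ?_) i s t (by omega)
    set l' := List.replicate k true ++ List.replicate (m - (k + 2)) false with hl'
    have e0 : (l k).Perm (false :: false :: l') := by
      simp only [hl, hl', show m - k = m - (k + 2) + 1 + 1 by omega,
        List.replicate_succ (a := false)]
      exact List.perm_middle.trans (List.perm_middle.cons _)
    have e1 : (l (k + 1)).Perm (true :: false :: l') := by
      simp only [hl, hl', show m - (k + 1) = m - (k + 2) + 1 by omega, List.replicate_succ,
        List.cons_append]
      exact List.perm_middle.cons _
    have e2 : l (k + 2) = true :: true :: l' := by
      simp only [hl, hl', List.replicate_succ, List.cons_append]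
    have h0 : a ε k = _ := removalSum_perm (x := x) (S := S) (e0.map (tiltWeight ε))
    have h1 : a ε (k + 1) = _ := removalSum_perm (x := x) (S := S) (e1.map (tiltWeight ε))
    have h2 : a ε (k + 2) = removalSum x S ((true :: true :: l').map (tiltWeight ε)) := by
      simp only [ha, e2]
    change a ε (k + 2) * a ε k ≤ a ε (k + 1) ^ 2
    rw [h0, h1, h2]
    simp only [List.map_cons]
    refine removalSum_mul_le_sq (hmap ε hε l') (htilt ε hε false) hx ?_
    simp only [hl', List.length_map, List.length_append, List.length_replicate]
    omega
  have hcont : ∀ k, Continuous fun ε => a ε k := fun k => continuous_removalSum_tiltWeight S (l k)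
  have hzero : ∀ k ≤ m, a 0 k = extCount x S k := by
    intro k hk
    rw [← removalSum_tiltWeight_zero k (m - k) hx (by omega)]
    simp [ha, hl]
  have hlim := le_of_tendsto_of_tendsto
    ((((hcont i).mul (hcont (i + s + t))).tendsto 0).mono_left nhdsWithin_le_nhds)
    ((((hcont (i + s)).mul (hcont (i + t))).tendsto 0).mono_left nhdsWithin_le_nhds)
    (Filter.eventually_of_mem (self_mem_nhdsWithin (s := Set.Ioi (0 : ℝ))) hineq)
  change a 0 i * a 0 (i + s + t) ≤ a 0 (i + s) * a 0 (i + t) at hlim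
  rwa [hzero _ (by omega), hzero _ (by omega), hzero _ (by omega), hzero _ (by omega)] at hlim

end Counting

section Sequences

/-- Second moment bound for one side of a log-concave distribution. -/
theorem sum_mul_sq_le_of_log_concave {a : ℕ → ℝ} {n : ℕ} {q : ℝ} (ha : ∀ d, 0 ≤ a d)
    (han : ∀ d, n ≤ d → a d = 0) (hsum : ∑ d ∈ range n, a d ≤ 1) (hq : 0 < q) (ha0 : a 0 = q)
    (hlc : ∀ s d, a 0 * a (d + s) ≤ a s * a d) :
    ∑ d ∈ range n, a d * (d : ℝ) ^ 2 ≤ 90 / q ^ 2 := by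
  have hext : ∀ (g : ℕ → ℝ) N, ∑ d ∈ range (n + N), a d * g d = ∑ d ∈ range n, a d * g d := by
    intro g N
    refine (Finset.sum_subset (Finset.range_mono (Nat.le_add_right n N)) fun d _ hd => ?_).symm
    rw [han d (by simpa using hd), zero_mul]
  have hsumN : ∀ N, ∑ d ∈ range N, a d ≤ 1 := by
    intro N
    have h1 := hext (fun _ => 1) N
    simp only [mul_one] at h1
    rw [← h1] at hsum
    exact (Finset.sum_le_sum_of_subset_of_nonneg (Finset.range_mono (Nat.le_add_left N n))
      fun d _ _ => ha d).trans hsum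
  have hq1 : q ≤ 1 := by simpa [ha0] using hsumN 1
  set r := ⌈2 / q⌉₊ with hr
  have hr1 : 2 / q ≤ r := Nat.le_ceil _
  have hr2 : (r : ℝ) ≤ 3 / q := by
    have h1 : (r : ℝ) < 2 / q + 1 := Nat.ceil_lt_add_one (by positivity)
    have h2 : 1 ≤ 1 / q := by rw [le_div_iff₀ hq]; linarith
    have h3 : 3 / q = 2 / q + 1 / q := by ring
    linarith
  obtain ⟨s, hs1, hs2⟩ : ∃ s, s ≤ r ∧ a s ≤ q / 2 := by
    by_contra hcon
    push Not at hcon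
    have h1 := hsumN (r + 1)
    rw [Finset.sum_range_succ', ha0] at h1
    have h2 : ∑ _d ∈ range r, q / 2 ≤ ∑ d ∈ range r, a (d + 1) :=
      Finset.sum_le_sum fun d hd => (hcon (d + 1) (by have := Finset.mem_range.1 hd; omega)).le
    rw [Finset.sum_const, Finset.card_range, nsmul_eq_mul] at h2
    rw [div_le_iff₀ hq] at hr1
    linarith
  have hhalf : ∀ d, a (s + d) ≤ a d / 2 := by
    intro d
    have h1 := hlc s d
    rw [ha0, add_comm d s] at h1
    have h2 := mul_le_mul_of_nonneg_right hs2 (ha d)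
    refine le_of_mul_le_mul_left ?_ hq
    linarith
  set M := ∑ d ∈ range n, a d * (d : ℝ) ^ 2 with hM
  have h1 : M = ∑ d ∈ range s, a d * (d : ℝ) ^ 2
      + ∑ d ∈ range n, a (s + d) * ((s + d : ℕ) : ℝ) ^ 2 := by
    rw [← Finset.sum_range_add, add_comm s n, hext]
  have h2 : ∑ d ∈ range s, a d * (d : ℝ) ^ 2 ≤ (s : ℝ) ^ 2 := by
    calc ∑ d ∈ range s, a d * (d : ℝ) ^ 2 ≤ ∑ d ∈ range s, a d * (s : ℝ) ^ 2 := by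
          refine Finset.sum_le_sum fun d hd => mul_le_mul_of_nonneg_left ?_ (ha d)
          have : (d : ℝ) ≤ s := by exact_mod_cast (Finset.mem_range.1 hd).le
          gcongr
      _ = (∑ d ∈ range s, a d) * (s : ℝ) ^ 2 := by rw [Finset.sum_mul]
      _ ≤ 1 * (s : ℝ) ^ 2 := mul_le_mul_of_nonneg_right (hsumN s) (sq_nonneg _)
      _ = (s : ℝ) ^ 2 := one_mul _
  have h3 : ∑ d ∈ range n, a (s + d) * ((s + d : ℕ) : ℝ) ^ 2
      ≤ 3 / 4 * M + 3 / 2 * (s : ℝ) ^ 2 := by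
    calc ∑ d ∈ range n, a (s + d) * ((s + d : ℕ) : ℝ) ^ 2
        ≤ ∑ d ∈ range n, (3 / 4 * (a d * (d : ℝ) ^ 2) + 3 / 2 * (s : ℝ) ^ 2 * a d) := by
          refine Finset.sum_le_sum fun d _ => ?_
          push_cast
          have e1 : ((s : ℝ) + d) ^ 2 ≤ 3 / 2 * (d : ℝ) ^ 2 + 3 * (s : ℝ) ^ 2 := by
            nlinarith [sq_nonneg ((d : ℝ) - 2 * s)]
          have e2 := mul_le_mul (hhalf d) e1 (sq_nonneg _) (by have := ha d; linarith)
          linarith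
      _ = 3 / 4 * M + 3 / 2 * (s : ℝ) ^ 2 * ∑ d ∈ range n, a d := by
          rw [Finset.sum_add_distrib, ← Finset.mul_sum, ← Finset.mul_sum]
      _ ≤ 3 / 4 * M + 3 / 2 * (s : ℝ) ^ 2 := by
          nlinarith [mul_le_mul_of_nonneg_left hsum (sq_nonneg (s : ℝ))]
  have h4 : M ≤ 10 * (s : ℝ) ^ 2 := by linarith
  have h5 : (s : ℝ) ≤ 3 / q := le_trans (by exact_mod_cast hs1) hr2
  have h6 : (s : ℝ) ^ 2 ≤ (3 / q) ^ 2 := by gcongr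
  have h7 : (90 : ℝ) / q ^ 2 = 10 * (3 / q) ^ 2 := by ring
  rw [h7]; linarith

/-- The second moment of a log-concave distribution about its mode. -/
theorem sum_mul_sub_mode_sq_le {p : ℕ → ℝ} {n k₀ : ℕ} (hp : ∀ k, 0 ≤ p k)
    (hsum : ∑ k ∈ range n, p k = 1) (hk₀ : k₀ < n) (hq : 0 < p k₀)
    (hlc : ∀ i s t, i + s + t < n → p i * p (i + s + t) ≤ p (i + s) * p (i + t)) :
    ∑ k ∈ range n, p k * ((k : ℝ) - k₀) ^ 2 ≤ 180 / p k₀ ^ 2 := by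
  obtain ⟨m, rfl⟩ : ∃ m, n = (k₀ + 1) + m := ⟨n - (k₀ + 1), by omega⟩
  set up : ℕ → ℝ := fun d => if d ≤ m then p (k₀ + d) else 0 with hup
  set down : ℕ → ℝ := fun d => if d ≤ k₀ then p (k₀ - d) else 0 with hdown
  have hsplit : ∀ g : ℕ → ℝ, ∑ k ∈ range (k₀ + 1 + m), g k
      = ∑ d ∈ range (k₀ + 1), g (k₀ - d) + ∑ d ∈ range m, g (k₀ + (d + 1)) := by
    intro g
    rw [Finset.sum_range_add, ← Finset.sum_range_reflect]
    congr 1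
    refine Finset.sum_congr rfl fun d _ => ?_
    congr 1
    omega
  have hupsum : ∀ g : ℕ → ℝ, ∑ d ∈ range (m + 1), up d * g d
      = ∑ d ∈ range m, p (k₀ + (d + 1)) * g (d + 1) + p k₀ * g 0 := by
    intro g
    rw [Finset.sum_range_succ']
    congr 1
    refine Finset.sum_congr rfl fun d hd => ?_
    have := Finset.mem_range.1 hd
    rw [hup]
    simp only [if_pos (show d + 1 ≤ m by omega)]
  have hdownsum : ∀ g : ℕ → ℝ, ∑ d ∈ range (k₀ + 1), down d * g d
      = ∑ d ∈ range (k₀ + 1), p (k₀ - d) * g d := by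
    intro g
    refine Finset.sum_congr rfl fun d hd => ?_
    have := Finset.mem_range.1 hd
    simp only [hdown, if_pos (show d ≤ k₀ by omega)]
  have hs := hsplit p
  rw [hsum] at hs
  have hnn1 : 0 ≤ ∑ d ∈ range m, p (k₀ + (d + 1)) := Finset.sum_nonneg fun _ _ => hp _
  have hupb := sum_mul_sq_le_of_log_concave (a := up) (n := m + 1) (q := p k₀)
    (fun d => by simp only [hup]; split_ifs; exacts [hp _, le_rfl])
    (fun d hd => by simp only [hup]; rw [if_neg (by omega)])
    (by
      have h1 := hupsum (fun _ => 1)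
      simp only [mul_one] at h1
      rw [h1]
      have h2 : p k₀ ≤ ∑ d ∈ range (k₀ + 1), p (k₀ - d) := by
        simpa using Finset.single_le_sum (f := fun d => p (k₀ - d)) (fun d _ => hp _)
          (Finset.mem_range.2 (Nat.succ_pos k₀))
      linarith) hq (by simp [hup])
    (fun s d => by
      simp only [hup, Nat.zero_le, if_true, add_zero]
      by_cases h : d + s ≤ m
      · rw [if_pos h, if_pos (show d ≤ m by omega), if_pos (show s ≤ m by omega)]
        have := hlc k₀ s d (by omega)
        rwa [show k₀ + (d + s) = k₀ + s + d by omega]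
      · rw [if_neg h, mul_zero]
        refine mul_nonneg ?_ ?_ <;> split_ifs <;> first | exact hp _ | exact le_rfl)
  have hdownb := sum_mul_sq_le_of_log_concave (a := down) (n := k₀ + 1) (q := p k₀)
    (fun d => by simp only [hdown]; split_ifs; exacts [hp _, le_rfl])
    (fun d hd => by simp only [hdown]; rw [if_neg (by omega)])
    (by
      have h1 := hdownsum (fun _ => 1)
      simp only [mul_one] at h1
      rw [h1]
      linarith) hq (by simp [hdown])
    (fun s d => by
      simp only [hdown, Nat.zero_le, if_true, Nat.sub_zero]
      by_cases h : d + s ≤ k₀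
      · rw [if_pos h, if_pos (show d ≤ k₀ by omega), if_pos (show s ≤ k₀ by omega)]
        have := hlc (k₀ - (d + s)) s d (by omega)
        rw [show k₀ - (d + s) + s + d = k₀ by omega, show k₀ - (d + s) + s = k₀ - d by omega,
          show k₀ - (d + s) + d = k₀ - s by omega] at this
        linarith
      · rw [if_neg h, mul_zero]
        refine mul_nonneg ?_ ?_ <;> split_ifs <;> first | exact hp _ | exact le_rfl)
  rw [hupsum fun d => (d : ℝ) ^ 2] at hupb
  rw [hdownsum fun d => (d : ℝ) ^ 2] at hdownb
  rw [hsplit]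
  have e1 : ∑ d ∈ range (k₀ + 1), p (k₀ - d) * (((k₀ - d : ℕ) : ℝ) - k₀) ^ 2
      = ∑ d ∈ range (k₀ + 1), p (k₀ - d) * (d : ℝ) ^ 2 := by
    refine Finset.sum_congr rfl fun d hd => ?_
    have := Finset.mem_range.1 hd
    rw [Nat.cast_sub (by omega)]; ring
  have e2 : ∑ d ∈ range m, p (k₀ + (d + 1)) * (((k₀ + (d + 1) : ℕ) : ℝ) - k₀) ^ 2
      = ∑ d ∈ range m, p (k₀ + (d + 1)) * ((d + 1 : ℕ) : ℝ) ^ 2 := by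
    refine Finset.sum_congr rfl fun d _ => ?_
    push_cast; ring
  rw [e1, e2]
  have e3 : (180 : ℝ) / p k₀ ^ 2 = 90 / p k₀ ^ 2 + 90 / p k₀ ^ 2 := by ring
  rw [e3]
  simp only [Nat.cast_zero, ne_eq, OfNat.ofNat_ne_zero, not_false_eq_true, zero_pow,
    mul_zero, add_zero] at hupb
  linarith

/-- An interval of length `r` centred at `μ` contains at most `r` natural numbers in its
interior. -/
theorem card_filter_near_le (n r : ℕ) (μ : ℝ) :
    #((range n).filter fun k : ℕ => |(k : ℝ) - μ| < r / 2) ≤ r := by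
  set a := μ - r / 2 with ha
  have hsub : ((range n).filter fun k : ℕ => |(k : ℝ) - μ| < r / 2).map Nat.castEmbedding
      ⊆ Finset.Ico (⌊a⌋ + 1) (⌊a⌋ + 1 + r) := by
    intro z hz
    obtain ⟨k, hk, rfl⟩ := Finset.mem_map.1 hz
    have hk' := abs_lt.1 (Finset.mem_filter.1 hk).2
    simp only [Nat.castEmbedding_apply, Finset.mem_Ico]
    constructor
    · have : ⌊a⌋ < (k : ℤ) := Int.floor_lt.2 (by push_cast; linarith)
      omega
    · have h1 : (k : ℝ) - r < a := by linarith
      have h2 : (((k : ℤ) - r : ℤ) : ℝ) ≤ a := by push_cast; exact h1.le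
      have := Int.le_floor.2 h2
      omega
  have := Finset.card_le_card hsub
  rw [Finset.card_map, Int.card_Ico] at this
  omega

theorem sum_mul_sub_sq_ge {p : ℕ → ℝ} {n : ℕ} {q : ℝ} (hp : ∀ k, 0 ≤ p k)
    (hsum : ∑ k ∈ range n, p k = 1) (hq : ∀ k < n, p k ≤ q) (hq0 : 0 ≤ q) (μ : ℝ) (r : ℕ) :
    (r / 2 : ℝ) ^ 2 * (1 - r * q) ≤ ∑ k ∈ range n, p k * ((k : ℝ) - μ) ^ 2 := by
  set N := (range n).filter fun k : ℕ => |(k : ℝ) - μ| < r / 2 with hN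
  have h1 : ∑ k ∈ N, p k ≤ r * q := by
    calc ∑ k ∈ N, p k ≤ ∑ _k ∈ N, q :=
          Finset.sum_le_sum fun k hk => hq k (Finset.mem_range.1 (Finset.mem_filter.1 hk).1)
      _ = #N * q := by rw [Finset.sum_const, nsmul_eq_mul]
      _ ≤ r * q := mul_le_mul_of_nonneg_right (by exact_mod_cast card_filter_near_le n r μ) hq0
  have h2 := Finset.sum_filter_add_sum_filter_not (range n) (fun k : ℕ => |(k : ℝ) - μ| < r / 2) p
  rw [hsum] at h2
  calc (r / 2 : ℝ) ^ 2 * (1 - r * q)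
      ≤ (r / 2 : ℝ) ^ 2 * ∑ k ∈ (range n).filter (fun k : ℕ => ¬ |(k : ℝ) - μ| < r / 2), p k := by
        refine mul_le_mul_of_nonneg_left ?_ (sq_nonneg _)
        linarith
    _ ≤ ∑ k ∈ (range n).filter (fun k : ℕ => ¬ |(k : ℝ) - μ| < r / 2), p k * ((k : ℝ) - μ) ^ 2 := by
        rw [Finset.mul_sum]
        refine Finset.sum_le_sum fun k hk => ?_
        rw [mul_comm]
        refine mul_le_mul_of_nonneg_left ?_ (hp k)
        rw [← sq_abs ((k : ℝ) - μ)]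
        have := not_lt.1 (Finset.mem_filter.1 hk).2
        gcongr
    _ ≤ ∑ k ∈ range n, p k * ((k : ℝ) - μ) ^ 2 :=
        Finset.sum_le_sum_of_subset_of_nonneg (Finset.filter_subset _ _)
          fun k _ _ => mul_nonneg (hp k) (sq_nonneg _)

/-- A distribution on the integers with all probabilities at most `q` has variance at least of
the order of `(1 / q - 1) ^ 2`. -/
theorem sq_le_sum_mul_sub_sq {p : ℕ → ℝ} {n : ℕ} {q : ℝ} (hp : ∀ k, 0 ≤ p k)
    (hsum : ∑ k ∈ range n, p k = 1) (hq : ∀ k < n, p k ≤ q) (hq0 : 0 < q) (hq1 : q ≤ 1) (μ : ℝ) :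
    (1 / 12 * (1 / q - 1)) ^ 2 ≤ ∑ k ∈ range n, p k * ((k : ℝ) - μ) ^ 2 := by
  set t := 1 / q with ht
  have htq : t * q = 1 := by rw [ht]; field_simp
  have ht1 : 1 ≤ t := by rw [ht, le_div_iff₀ hq0]; linarith
  have key := sum_mul_sub_sq_ge hp hsum hq hq0.le μ
  by_cases h : 1 / 4 ≤ q
  · refine le_trans ?_ (key 1)
    push_cast
    have ht4 : t ≤ 4 := by rw [ht, div_le_iff₀ hq0]; linarith
    have e : t - 1 = t * (1 - q) := by linear_combination htq
    rw [e]
    have h1 : 0 ≤ 1 - q := by linarith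
    have h2 : t ^ 2 ≤ 16 := by nlinarith
    have h3 : (1 - q) ^ 2 ≤ 1 - q := by nlinarith
    nlinarith [mul_le_mul h2 h3 (sq_nonneg _) (by norm_num)]
  · push Not at h
    have ht4 : 4 < t := by rw [ht, lt_div_iff₀ hq0]; linarith
    set r := ⌊t / 2⌋₊ with hr
    have hr1 : (r : ℝ) ≤ t / 2 := Nat.floor_le (by linarith)
    have hr2 : t / 2 < r + 1 := Nat.lt_floor_add_one _
    refine le_trans ?_ (key r)
    have h1 : (r : ℝ) * q ≤ 1 / 2 := by nlinarith
    have h2 : t / 4 ≤ r := by linarith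
    have h3 : (t / 8) ^ 2 ≤ (r / 2 : ℝ) ^ 2 := by
      have : t / 8 ≤ r / 2 := by linarith
      gcongr
    have h4 : (1 / 12 * (t - 1)) ^ 2 ≤ (1 / 12 * t) ^ 2 := by
      have : 0 ≤ t - 1 := by linarith
      gcongr
      linarith
    nlinarith [mul_le_mul h3 (show (1 / 2 : ℝ) ≤ 1 - r * q by linarith) (by norm_num) (sq_nonneg _)]

/-- The second moment is smallest about the mean. -/
theorem sum_mul_sub_mean_sq_le {p : ℕ → ℝ} {n : ℕ} (hsum : ∑ k ∈ range n, p k = 1) (c : ℝ) :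
    ∑ k ∈ range n, p k * ((k : ℝ) - ∑ j ∈ range n, p j * j) ^ 2
      ≤ ∑ k ∈ range n, p k * ((k : ℝ) - c) ^ 2 := by
  set μ := ∑ j ∈ range n, p j * (j : ℝ) with hμ
  have : ∑ k ∈ range n, p k * ((k : ℝ) - c) ^ 2
      = ∑ k ∈ range n, p k * ((k : ℝ) - μ) ^ 2 + (μ - c) ^ 2 := by
    have e : ∀ k : ℕ, p k * ((k : ℝ) - c) ^ 2 = p k * ((k : ℝ) - μ) ^ 2
        + 2 * (μ - c) * (p k * k) + ((μ - c) ^ 2 - 2 * (μ - c) * μ) * p k := by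
      intro k; ring
    simp only [e, Finset.sum_add_distrib, ← Finset.mul_sum, hsum, ← hμ]
    ring
  rw [this]
  linarith [sq_nonneg (μ - c)]

end Sequences

section LinearExtensions

variable {β : Type*} [Fintype β] [PartialOrder β]

theorem card_val_eq (x : β) (k : ℕ) :
    Nat.card {f : LinExt β // val f x = k + 1} = extCount x Finset.univ k := by
  refine Nat.card_congr (Equiv.ofBijective
    (fun f => ⟨fun z => (f.1.1 z : ℕ), ?_, ?_, ?_, ?_, ?_⟩) ⟨?_, ?_⟩)
  · intro z hz
    exact absurd (Finset.mem_univ z) hz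
  · intro y _ z _ h
    exact f.1.1.injective (Fin.ext h)
  · intro z _
    exact (f.1.1 z).2
  · intro y _ z _ h
    exact f.1.2 y z h
  · exact Nat.succ_injective f.2
  · intro f g h
    refine Subtype.ext (Subtype.ext (Equiv.ext fun z => Fin.ext ?_))
    exact congrFun (congrArg Subtype.val h) z
  · rintro ⟨f, hf⟩
    have hinj : Function.Injective
        (fun z => (⟨f z, hf.lt_card z (Finset.mem_univ z)⟩ : Fin (Fintype.card β))) := by
      intro y z h
      exact hf.inj y (Finset.mem_univ y) z (Finset.mem_univ z) (congrArg Fin.val h)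
    refine ⟨⟨⟨Equiv.ofBijective _ ((Fintype.bijective_iff_injective_and_card _).2
      ⟨hinj, (Fintype.card_fin _).symm⟩), fun y z h => ?_⟩, ?_⟩, ?_⟩
    · exact hf.mono y (Finset.mem_univ y) z (Finset.mem_univ z) h
    · exact congrArg Nat.succ hf.apply_eq
    · rfl

/-- Averages over linear extensions of a function of the value at `x`. -/
theorem sum_linExt_div_card (x : β) (g : ℕ → ℝ) :
    (∑ f : LinExt β, g (val f x)) / (Nat.card (LinExt β) : ℝ)
      = ∑ k ∈ range (Fintype.card β), Pr (fun f => val f x = k + 1) * g (k + 1) := by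
  classical
  have hmaps : ∀ f ∈ (Finset.univ : Finset (LinExt β)),
      val f x - 1 ∈ range (Fintype.card β) := fun f _ => Finset.mem_range.2 (f.1 x).2
  rw [← Finset.sum_fiberwise_of_maps_to hmaps, Finset.sum_div]
  refine Finset.sum_congr rfl fun k _ => ?_
  have h0 : ∀ f : LinExt β, val f x - 1 = k ↔ val f x = k + 1 := fun f =>
    Nat.succ_inj.symm
  have h1 : ∑ f : LinExt β with val f x - 1 = k, g (val f x)
      = ∑ f : LinExt β with val f x - 1 = k, g (k + 1) :=
    Finset.sum_congr rfl fun f hf => by rw [(h0 f).1 (Finset.mem_filter.1 hf).2]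
  have h2 : Nat.card {f : LinExt β // val f x = k + 1} = #{f : LinExt β | val f x - 1 = k} := by
    rw [Nat.card_eq_fintype_card, Fintype.card_subtype]
    simp only [h0]
  rw [h1, Finset.sum_const, nsmul_eq_mul, Pr, h2]
  ring

theorem pr_nonneg (E : LinExt β → Prop) : 0 ≤ Pr E := by
  unfold Pr; positivity

theorem pr_le_one (E : LinExt β → Prop) : Pr E ≤ 1 := by
  refine div_le_one_of_le₀ ?_ (Nat.cast_nonneg _)
  exact_mod_cast Nat.card_le_card_of_injective _ Subtype.val_injective

theorem sum_pr_val_eq [Nonempty (LinExt β)] (x : β) :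
    ∑ k ∈ range (Fintype.card β), Pr (fun f => val f x = k + 1) = 1 := by
  have h := sum_linExt_div_card x fun _ => 1
  simp only [mul_one, Finset.sum_const, Finset.card_univ, nsmul_eq_mul] at h
  rw [← h, Nat.card_eq_fintype_card]
  exact div_self (by exact_mod_cast Fintype.card_ne_zero)

theorem pr_val_mul_le (x : β) (i s t : ℕ) (h : i + s + t < Fintype.card β) :
    Pr (fun f => val f x = i + 1) * Pr (fun f => val f x = i + s + t + 1)
      ≤ Pr (fun f => val f x = i + s + 1) * Pr (fun f => val f x = i + t + 1) := by
  simp only [Pr, card_val_eq]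
  rw [div_mul_div_comm, div_mul_div_comm]
  exact div_le_div_of_nonneg_right (extCount_mul_le_mul (Finset.mem_univ x) i s t h)
    (by positivity)

theorem exists_qVal_eq (x : β) :
    ∃ k < Fintype.card β, qVal x = Pr fun f => val f x = k + 1 := by
  have : Nonempty (Fin (Fintype.card β)) := ⟨⟨0, Fintype.card_pos_iff.2 ⟨x⟩⟩⟩
  obtain ⟨k, hk⟩ := exists_eq_ciSup_of_finite
    (f := fun k : Fin (Fintype.card β) => Pr fun f => val f x = (k : ℕ) + 1)
  exact ⟨k, k.2, hk.symm⟩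

theorem pr_val_le_qVal (x : β) {k : ℕ} (hk : k < Fintype.card β) :
    Pr (fun f => val f x = k + 1) ≤ qVal x :=
  le_ciSup (f := fun k : Fin (Fintype.card β) => Pr fun f => val f x = (k : ℕ) + 1)
    (Set.finite_range _).bddAbove ⟨k, hk⟩

theorem qVal_pos [Nonempty (LinExt β)] (x : β) : 0 < qVal x := by
  by_contra hq
  have h := sum_pr_val_eq x
  rw [Finset.sum_eq_zero fun k hk => le_antisymm
    ((pr_val_le_qVal x (Finset.mem_range.1 hk)).trans (not_lt.1 hq)) (pr_nonneg _)] at h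
  exact zero_ne_one h

theorem variance_eq [Nonempty (LinExt β)] (x : β) :
    variance x = ∑ k ∈ range (Fintype.card β), Pr (fun f => val f x = k + 1)
      * ((k : ℝ) - ∑ j ∈ range (Fintype.card β), Pr (fun f => val f x = j + 1) * (j : ℝ)) ^ 2 := by
  have he : expec x
      = ∑ j ∈ range (Fintype.card β), Pr (fun f => val f x = j + 1) * (j : ℝ) + 1 := by
    have h := sum_linExt_div_card x fun j => (j : ℝ)
    simp only [Nat.cast_add, Nat.cast_one, mul_add, mul_one,
      Finset.sum_add_distrib (s := range _), sum_pr_val_eq] at h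
    exact h
  have h := sum_linExt_div_card x fun k => ((k : ℝ) - expec x) ^ 2
  simp only [he, Nat.cast_add, Nat.cast_one, add_sub_add_right_eq_sub] at h
  rw [variance, he, h]

theorem mul_one_div_qVal_sub_one_le_sigma [Nonempty (LinExt β)] (x : β) :
    1 / 12 * (1 / qVal x - 1) ≤ sigma x := by
  have hq1 : qVal x ≤ 1 := by
    obtain ⟨k, -, hk⟩ := exists_qVal_eq x
    exact hk ▸ pr_le_one _
  refine Real.le_sqrt_of_sq_le ?_
  rw [variance_eq]
  exact sq_le_sum_mul_sub_sq (fun _ => pr_nonneg _) (sum_pr_val_eq x)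
    (fun k hk => pr_val_le_qVal x hk) (qVal_pos x) hq1 _

theorem sigma_le_div_qVal [Nonempty (LinExt β)] (x : β) : sigma x ≤ 14 / qVal x := by
  obtain ⟨k, hk, hqk⟩ := exists_qVal_eq x
  have hq := qVal_pos x
  refine Real.sqrt_le_iff.2 ⟨by positivity, ?_⟩
  rw [variance_eq]
  refine (sum_mul_sub_mean_sq_le (sum_pr_val_eq x) k).trans
    ((sum_mul_sub_mode_sq_le (p := fun k => Pr fun f => val f x = k + 1) (fun _ => pr_nonneg _)
      (sum_pr_val_eq x) hk (hqk ▸ hq) (pr_val_mul_le x)).trans ?_)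
  rw [← hqk, div_pow]
  gcongr
  norm_num

end LinearExtensions

/-- there are universal constants `c, C > 0` with
`c (1/q(x) - 1) ≤ σ(x) ≤ C / q(x)` for every finite poset and every `x`. -/
theorem stmt_10 :
    ∃ c C : ℝ, 0 < c ∧ 0 < C ∧
      ∀ (β : Type) [Fintype β] [PartialOrder β] (x : β),
        c * (1 / qVal x - 1) ≤ sigma x ∧ sigma x ≤ C / qVal x := by
  refine ⟨1 / 12, 14, by norm_num, by norm_num, fun β _ _ x => ?_⟩
  cases isEmpty_or_nonempty (LinExt β) with
  | inl h =>
    obtain ⟨k, -, hk⟩ := exists_qVal_eq x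
    have hq : qVal x = 0 := by rw [hk, Pr, Nat.card_of_isEmpty, Nat.cast_zero, zero_div]
    have hs : sigma x = 0 := by
      rw [sigma, variance, Nat.card_of_isEmpty, Nat.cast_zero, div_zero, Real.sqrt_zero]
    rw [hq, hs]
    norm_num
  | inr h => exact ⟨mul_one_div_qVal_sub_one_le_sigma x, sigma_le_div_qVal x⟩
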